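/- A function F : (ℂ⁺)ⁿ → ℂ is a Herglotz-Nevanlinna function in n variables (holomorphic with Im F ≥ 0) if and only if there exist a real number a, a vector b⃗ ∈ [0,∞)ⁿ, and a positive Borel measure μ on ℝⁿ satisfying the Nevanlinna condition and the growth condition ∫_{ℝⁿ} ∏_{ℓ=1}^n (1 + t_ℓ²)^{-1} dμ(t⃗) < ∞, such that F(z⃗) = a + Σ_{ℓ=1}^n b_ℓ z_ℓ + (1/πⁿ) ∫_{ℝⁿ} K_n(z⃗, t⃗) dμ(t⃗) for all z⃗ ∈ (ℂ⁺)ⁿ. Furthermore, for a given such F, the triple of representing parameters (a, b⃗, μ) is unique. -/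

import Mathlib

open MeasureTheory
open scoped ComplexConjugate ENNReal

/-- The kernel `K_n(z, t)` of the integral representation of Herglotz-Nevanlinna
functions in `n` variables. -/
noncomputable def herglotzKernel (n : ℕ) (z : Fin n → ℂ) (t : Fin n → ℝ) : ℂ :=
  Complex.I * ((2 / (2 * Complex.I) ^ n)
      * ∏ ℓ, (1 / ((t ℓ : ℂ) - z ℓ) - 1 / ((t ℓ : ℂ) + Complex.I))
    - (1 / (2 * Complex.I) ^ n)
      * ∏ ℓ, (1 / ((t ℓ : ℂ) - Complex.I) - 1 / ((t ℓ : ℂ) + Complex.I)))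

/-- The Nevanlinna condition on a positive Borel measure `μ` on `ℝⁿ`: for all
`z ∈ (ℂ⁺)ⁿ` and all indices `ℓ₁ < ℓ₂`,
`∫ (t_{ℓ₁} - z_{ℓ₁})⁻² (t_{ℓ₂} - conj z_{ℓ₂})⁻² ∏_{j ≠ ℓ₁, ℓ₂} (1/(t_j - z_j) - 1/(t_j - conj z_j)) dμ = 0`. -/
def NevanlinnaCondition (n : ℕ) (μ : Measure (Fin n → ℝ)) : Prop :=
  ∀ z : Fin n → ℂ, (∀ k, 0 < (z k).im) → ∀ ℓ₁ ℓ₂ : Fin n, ℓ₁ < ℓ₂ →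
    (∫ t : Fin n → ℝ,
      (((t ℓ₁ : ℂ) - z ℓ₁) ^ 2)⁻¹ * (((t ℓ₂ : ℂ) - conj (z ℓ₂)) ^ 2)⁻¹ *
        ∏ j ∈ Finset.univ \ {ℓ₁, ℓ₂},
          (1 / ((t j : ℂ) - z j) - 1 / ((t j : ℂ) - conj (z j))) ∂μ) = 0

/-- The growth condition `∫_{ℝⁿ} ∏_ℓ (1 + t_ℓ²)⁻¹ dμ(t) < ∞`. -/
def HerglotzGrowthCondition (n : ℕ) (μ : Measure (Fin n → ℝ)) : Prop :=
  (∫⁻ t : Fin n → ℝ, ∏ ℓ, ENNReal.ofReal (1 / (1 + t ℓ ^ 2)) ∂μ) < ⊤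

/-- The integral representation
`F(z) = a + ∑_ℓ b_ℓ z_ℓ + (1/πⁿ) ∫_{ℝⁿ} K_n(z, t) dμ(t)` with `a ∈ ℝ`,
`b ∈ [0, ∞)ⁿ` and `μ` a positive Borel measure on `ℝⁿ` satisfying the Nevanlinna
condition and the growth condition. -/
def HerglotzNvarRep (n : ℕ) (F : (Fin n → ℂ) → ℂ) (a : ℝ) (b : Fin n → ℝ)
    (μ : Measure (Fin n → ℝ)) : Prop :=
  (∀ ℓ, 0 ≤ b ℓ) ∧ NevanlinnaCondition n μ ∧ HerglotzGrowthCondition n μ ∧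
  ∀ z : Fin n → ℂ, (∀ k, 0 < (z k).im) →
    F z = (a : ℂ) + ∑ ℓ, (b ℓ : ℂ) * z ℓ
      + (1 / (Real.pi : ℂ) ^ n) * ∫ t : Fin n → ℝ, herglotzKernel n z t ∂μ

open AddCircle in
/-- The character `x ↦ exp (2πix)` identifying `ℝ / ℤ` with the unit circle of `ℂ`. -/
noncomputable def circleCoord (x : UnitAddCircle) : ℂ := toCircle x

lemma fourier_eq_circleCoord_zpow (k : ℤ) (x : UnitAddCircle) :
    fourier k x = circleCoord x ^ k := by
  simp [circleCoord, AddCircle.toCircle_zsmul]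

@[simp] lemma norm_circleCoord (x : UnitAddCircle) : ‖circleCoord x‖ = 1 := Circle.norm_coe _

@[simp] lemma circleCoord_ne_zero (x : UnitAddCircle) : circleCoord x ≠ 0 := Circle.coe_ne_zero _

@[fun_prop] lemma continuous_circleCoord : Continuous circleCoord :=
  continuous_induced_dom.comp AddCircle.continuous_toCircle

lemma conj_circleCoord (x : UnitAddCircle) : conj (circleCoord x) = (circleCoord x)⁻¹ := by
  rw [circleCoord, ← Circle.coe_inv_eq_conj, Circle.coe_inv]

lemma circleCoord_eq_one_iff {x : UnitAddCircle} : circleCoord x = 1 ↔ x = 0 := by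
  constructor
  · intro h
    apply AddCircle.injective_toCircle one_ne_zero
    rw [AddCircle.toCircle_zero]
    exact Circle.ext h
  · rintro rfl
    simp [circleCoord]

lemma integral_haarAddCircle_eq_circleAverage (g : ℂ → ℂ) :
    ∫ x : UnitAddCircle, g (circleCoord x) ∂AddCircle.haarAddCircle = Real.circleAverage g 0 1 := by
  rw [AddCircle.integral_haarAddCircle, ← UnitAddCircle.intervalIntegral_preimage 0,
    Real.circleAverage_def, inv_one, one_smul]
  have : ∀ a : ℝ, g (circleCoord (a : UnitAddCircle)) = (fun θ => g (circleMap 0 1 θ)) (2 * Real.pi * a) := by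
    intro a
    simp only [circleMap, circleCoord, AddCircle.toCircle_apply_mk]
    congr 1
    simp
  simp_rw [this]
  rw [intervalIntegral.integral_comp_mul_left (fun θ => g (circleMap 0 1 θ)) (by positivity)]
  simp

/-- The Cauchy kernel `1 / (1 - w ζ⁻¹)` of the unit disc at the boundary point `ζ`. -/
noncomputable def cauchyKernel (w : ℂ) (x : UnitAddCircle) : ℂ :=
  (1 - w * conj (circleCoord x))⁻¹

lemma one_sub_mul_ne_zero {w u : ℂ} (hw : ‖w‖ < 1) (hu : ‖u‖ ≤ 1) : 1 - w * u ≠ 0 := by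
  intro h
  have h1 : w * u = 1 := (sub_eq_zero.mp h).symm
  have h2 := congrArg norm h1
  rw [norm_mul, norm_one] at h2
  nlinarith [norm_nonneg w, norm_nonneg u]

lemma one_sub_mul_conj_circleCoord_ne_zero {w : ℂ} (hw : ‖w‖ < 1) (x : UnitAddCircle) :
    1 - w * conj (circleCoord x) ≠ 0 :=
  one_sub_mul_ne_zero hw (by simp)

lemma continuous_cauchyKernel {w : ℂ} (hw : ‖w‖ < 1) : Continuous (cauchyKernel w) := by
  unfold cauchyKernel
  exact Continuous.inv₀ (by fun_prop) (one_sub_mul_conj_circleCoord_ne_zero hw)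

lemma conj_cauchyKernel (w : ℂ) (x : UnitAddCircle) :
    conj (cauchyKernel w x) = (1 - conj w * circleCoord x)⁻¹ := by
  simp [cauchyKernel]

lemma cauchyKernel_eq_div (w : ℂ) (x : UnitAddCircle) :
    cauchyKernel w x = circleCoord x / (circleCoord x - w) := by
  rw [cauchyKernel, conj_circleCoord]
  have := circleCoord_ne_zero x
  rw [← div_eq_mul_inv, one_sub_div this, inv_div]

lemma integral_cauchyKernel_mul {h : ℂ → ℂ} (hh : DiffContOnCl ℂ h (Metric.ball 0 1)) {w : ℂ}
    (hw : ‖w‖ < 1) :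
    ∫ x, cauchyKernel w x * h (circleCoord x) ∂AddCircle.haarAddCircle = h w := by
  simp_rw [cauchyKernel_eq_div]
  rw [integral_haarAddCircle_eq_circleAverage fun ζ => ζ / (ζ - w) * h ζ]
  have := DiffContOnCl.circleAverage_smul_div (f := h) (c := 0) (R := 1) (w := w)
    (by simpa using hh) (by simpa using hw)
  simpa using this

lemma integral_comp_circleCoord {h : ℂ → ℂ} (hh : DiffContOnCl ℂ h (Metric.ball 0 1)) :
    ∫ x, h (circleCoord x) ∂AddCircle.haarAddCircle = h 0 := by
  rw [integral_haarAddCircle_eq_circleAverage]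
  exact DiffContOnCl.circleAverage (by simpa using hh)

lemma integral_conj_cauchyKernel_mul {h : ℂ → ℂ} (hh : DiffContOnCl ℂ h (Metric.ball 0 1))
    {w : ℂ} (hw : ‖w‖ < 1) :
    ∫ x, conj (cauchyKernel w x) * h (circleCoord x) ∂AddCircle.haarAddCircle = h 0 := by
  simp_rw [conj_cauchyKernel]
  have hne : ∀ x ∈ closure (Metric.ball (0 : ℂ) 1), 1 - conj w * x ≠ 0 := by
    intro x hx
    rw [closure_ball _ one_ne_zero, mem_closedBall_zero_iff] at hx
    exact one_sub_mul_ne_zero (by simpa using hw) hx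
  have := integral_comp_circleCoord (h := fun ζ => (1 - conj w * ζ)⁻¹ • h ζ)
    ((DiffContOnCl.inv (Differentiable.diffContOnCl (by fun_prop)) hne).smul hh)
  simpa using this

lemma integral_fourier_mul {h : ℂ → ℂ} (hh : DiffContOnCl ℂ h (Metric.ball 0 1)) {k : ℤ}
    (hk : 0 < k) :
    ∫ x : UnitAddCircle, fourier k x * h (circleCoord x) ∂AddCircle.haarAddCircle = 0 := by
  lift k to ℕ using hk.le
  have h1 : DiffContOnCl ℂ (fun ζ : ℂ => ζ ^ k) (Metric.ball 0 1) :=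
    Differentiable.diffContOnCl (by fun_prop)
  have := integral_comp_circleCoord (h := fun ζ => ζ ^ k • h ζ) (h1.smul hh)
  have hk' : k ≠ 0 := by omega
  simpa [fourier_eq_circleCoord_zpow, hk', -fourier_apply] using this

lemma integral_fourier_eq_zero {k : ℤ} (hk : k ≠ 0) :
    ∫ x : UnitAddCircle, fourier k x ∂AddCircle.haarAddCircle = 0 := by
  have key : ∀ k : ℤ, 0 < k → ∫ x : UnitAddCircle, fourier k x ∂AddCircle.haarAddCircle = 0 := by
    intro k hk
    simpa using integral_fourier_mul (h := fun _ => 1) diffContOnCl_const hk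
  rcases hk.lt_or_gt with h | h
  · have := congrArg conj (key (-k) (by omega))
    rw [← integral_conj] at this
    simpa only [fourier_neg, Complex.conj_conj, map_zero] using this
  · exact key k h

lemma integral_fourier_mul_cauchyKernel_sq {w : ℂ} (hw : ‖w‖ < 1) (k : ℕ) :
    ∫ x : UnitAddCircle, fourier k x * cauchyKernel w x ^ 2 ∂AddCircle.haarAddCircle =
      (k + 1) * w ^ k := by
  simp_rw [cauchyKernel_eq_div, fourier_eq_circleCoord_zpow]
  rw [integral_haarAddCircle_eq_circleAverage fun ζ => ζ ^ (k : ℤ) * (ζ / (ζ - w)) ^ 2,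
    Real.circleAverage_eq_circleIntegral one_ne_zero]
  have := Complex.two_pi_I_inv_smul_circleIntegral_sub_sq_inv_smul_of_differentiable (U := Set.univ)
    (c := 0) (R := 1) (w₀ := w) (f := fun ζ : ℂ => ζ ^ (k + 1)) isOpen_univ (Set.subset_univ _)
    (by fun_prop) (by simpa using hw)
  simp only [deriv_pow_field, Nat.add_sub_cancel] at this
  push_cast at this
  rw [← this]
  congr 1
  apply circleIntegral.integral_congr zero_le_one
  intro z hz
  have hz1 : ‖z‖ = 1 := by simpa using hz
  have hz0 : z ≠ 0 := by intro h; simp [h] at hz1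
  have : z - w ≠ 0 := by
    intro h
    rw [sub_eq_zero.mp h] at hz1
    linarith
  simp only [sub_zero, smul_eq_mul, zpow_natCast]
  field_simp
  ring

lemma haarAddCircle_singleton (x : UnitAddCircle) :
    (AddCircle.haarAddCircle : Measure UnitAddCircle) {x} = 0 := by
  have : Nontrivial UnitAddCircle := ⟨0, ((1 / 2 : ℝ) : UnitAddCircle), by
    intro h
    have := (AddCircle.coe_eq_zero_iff 1).mp h.symm
    obtain ⟨n, hn⟩ := this
    have h2 : (2 * n : ℝ) = 1 := by simp at hn; linarith
    norm_cast at h2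
    omega⟩
  have : ConnectedSpace UnitAddCircle := inferInstance
  have : (nhdsWithin (0 : UnitAddCircle) {0}ᶜ).NeBot := inferInstance
  exact measure_singleton x

/-- The continuous functions on the circle whose Fourier spectrum lies in `s`. -/
noncomputable def fourierSpan (s : Set ℤ) : Submodule ℂ C(UnitAddCircle, ℂ) :=
  (Submodule.span ℂ (fourier '' s)).topologicalClosure

lemma fourier_mem_fourierSpan {s : Set ℤ} {k : ℤ} (hk : k ∈ s) : fourier k ∈ fourierSpan s :=
  Submodule.le_topologicalClosure _ (Submodule.subset_span ⟨k, hk, rfl⟩)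

lemma fourierSpan_univ : fourierSpan Set.univ = ⊤ := by
  rw [fourierSpan, Set.image_univ, span_fourier_closure_eq_top]

lemma mem_fourierSpan_of_hasSum {s : Set ℤ} {f : C(UnitAddCircle, ℂ)} {a : ℕ → ℂ} {p : ℕ → ℤ}
    (ha : Summable fun k => ‖a k‖) (hp : ∀ k, p k ∈ s)
    (hf : ∀ x, HasSum (fun k => a k * fourier (p k) x) (f x)) : f ∈ fourierSpan s := by
  have hs : Summable fun k => a k • (fourier (p k) : C(UnitAddCircle, ℂ)) := by
    refine Summable.of_norm ?_
    simpa [norm_smul, fourier_norm] using ha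
  have hsum : HasSum (fun k => a k • (fourier (p k) : C(UnitAddCircle, ℂ))) f := by
    convert hs.hasSum
    ext x
    refine (hf x).unique ?_
    simpa using ContinuousMap.hasSum_apply hs.hasSum x
  refine (Submodule.isClosed_topologicalClosure _).mem_of_tendsto hsum
    (Filter.Eventually.of_forall fun t => Submodule.sum_mem _ fun k _ => ?_)
  exact Submodule.smul_mem _ _ (fourier_mem_fourierSpan (hp k))

/-- The function `∏ j, g j (x j)` on the torus. -/
noncomputable def torusProd {n : ℕ} (g : Fin n → C(UnitAddCircle, ℂ)) :
    C(Fin n → UnitAddCircle, ℂ) :=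
  ∏ j, (g j).comp ⟨fun x => x j, continuous_apply j⟩

@[simp] lemma torusProd_apply {n : ℕ} (g : Fin n → C(UnitAddCircle, ℂ))
    (x : Fin n → UnitAddCircle) : torusProd g x = ∏ j, g j (x j) := by
  simp [torusProd, ContinuousMap.prod_apply]

lemma torusProd_update {n : ℕ} (g : Fin n → C(UnitAddCircle, ℂ)) (j : Fin n)
    (h : C(UnitAddCircle, ℂ)) :
    torusProd (Function.update g j h) =
      h.comp ⟨fun x => x j, continuous_apply j⟩ *
        ∏ i ∈ Finset.univ \ {j}, (g i).comp ⟨fun x => x i, continuous_apply i⟩ := by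
  ext x
  simp only [torusProd_apply, ContinuousMap.mul_apply, ContinuousMap.prod_apply]
  rw [← Finset.mul_prod_erase _ _ (Finset.mem_univ j), Finset.sdiff_singleton_eq_erase]
  simp only [Function.update_self, ContinuousMap.comp_apply, ContinuousMap.coe_mk]
  congr 1
  refine Finset.prod_congr rfl fun i hi => ?_
  rw [Function.update_of_ne (Finset.ne_of_mem_erase hi)]

lemma map_torusProd_eq_zero {n : ℕ} (L : C(Fin n → UnitAddCircle, ℂ) →L[ℂ] ℂ)
    {s : Fin n → Set ℤ}
    (hL : ∀ k : Fin n → ℤ, (∀ j, k j ∈ s j) → L (torusProd fun j => fourier (k j)) = 0)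
    {g : Fin n → C(UnitAddCircle, ℂ)} (hg : ∀ j, g j ∈ fourierSpan (s j)) :
    L (torusProd g) = 0 := by
  have key : ∀ (A : Finset (Fin n)) (g : Fin n → C(UnitAddCircle, ℂ)),
      (∀ j ∈ A, g j ∈ fourierSpan (s j)) → (∀ j ∉ A, g j ∈ fourier '' s j) →
      L (torusProd g) = 0 := by
    intro A
    induction A using Finset.induction_on with
    | empty =>
      intro g _ hg
      choose k hk hk' using fun j => hg j (Finset.notMem_empty j)
      simpa [hk', funext_iff] using hL k hk
    | insert i A hi ih =>
      intro g h1 h2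
      let M : C(UnitAddCircle, ℂ) →ₗ[ℂ] ℂ :=
        { toFun := fun h => L (torusProd (Function.update g i h))
          map_add' := fun h h' => by
            simp [torusProd_update, ContinuousMap.add_comp, add_mul]
          map_smul' := fun c h => by
            rw [torusProd_update, torusProd_update, ContinuousMap.smul_comp, smul_mul_assoc,
              map_smul, RingHom.id_apply] }
      have hM : Continuous M := by
        change Continuous fun h => L (torusProd (Function.update g i h))
        simp_rw [torusProd_update]
        exact L.continuous.comp ((ContinuousMap.continuous_precomp _).mul continuous_const)
      have hle : fourierSpan (s i) ≤ LinearMap.ker M := by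
        refine Submodule.topologicalClosure_minimal _ (Submodule.span_le.mpr ?_) ?_
        · intro h hh
          refine ih _ (fun j hj => ?_) (fun j hj => ?_)
          · have hne : j ≠ i := fun e => hi (e ▸ hj)
            rw [Function.update_of_ne hne]
            exact h1 j (Finset.mem_insert_of_mem hj)
          · by_cases hji : j = i
            · subst hji
              simpa using hh
            · rw [Function.update_of_ne hji]
              exact h2 j (by simp [hji, hj])
        · exact isClosed_singleton.preimage hM
      have : M (g i) = 0 := hle (h1 i (Finset.mem_insert_self i A))
      simpa [M] using this
  exact key Finset.univ g (fun j _ => hg j) (fun j hj => absurd (Finset.mem_univ j) hj)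

section
variable {X : Type*} [TopologicalSpace X] [CompactSpace X] [MeasurableSpace X] [BorelSpace X]

lemma ContinuousMap.integrable_of_isFiniteMeasure (σ : Measure X) [IsFiniteMeasure σ] (f : C(X, ℂ)) :
    Integrable f σ :=
  f.continuous.integrable_of_hasCompactSupport (HasCompactSupport.of_compactSpace _)

/-- Integration against a finite measure as a continuous linear functional on `C(X, ℂ)`. -/
noncomputable def integralFunctional (σ : Measure X) [IsFiniteMeasure σ] : C(X, ℂ) →L[ℂ] ℂ :=
  LinearMap.mkContinuous
    { toFun := fun f => ∫ x, f x ∂σ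
      map_add' := fun f g => integral_add (f.integrable_of_isFiniteMeasure σ)
        (g.integrable_of_isFiniteMeasure σ)
      map_smul' := fun c f => integral_const_mul c _ }
    (σ.real Set.univ) fun f => by
      rw [mul_comm]
      exact norm_integral_le_of_norm_le_const (Filter.Eventually.of_forall f.norm_coe_le_norm)

lemma integralFunctional_apply (σ : Measure X) [IsFiniteMeasure σ] (f : C(X, ℂ)) :
    integralFunctional σ f = ∫ x, f x ∂σ := rfl

end

/-- A measure on the torus is mixed-free if its Fourier coefficients vanish at all multi-indices
having both a positive and a negative entry. -/
def MixedFree {n : ℕ} (σ : Measure (Fin n → UnitAddCircle)) : Prop :=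
  ∀ k : Fin n → ℤ, (∃ i, 0 < k i) → (∃ j, k j < 0) → ∫ x, ∏ l, fourier (k l) (x l) ∂σ = 0

lemma MixedFree.integral_eq_zero {n : ℕ} {σ : Measure (Fin n → UnitAddCircle)}
    [IsFiniteMeasure σ] (hσ : MixedFree σ) {g : Fin n → C(UnitAddCircle, ℂ)} {i j : Fin n}
    (hi : g i ∈ fourierSpan (Set.Ioi 0)) (hj : g j ∈ fourierSpan (Set.Iio 0)) (hij : i ≠ j) :
    ∫ x, ∏ l, g l (x l) ∂σ = 0 := by
  have := map_torusProd_eq_zero (integralFunctional σ) (g := g)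
    (s := fun l => if l = i then Set.Ioi 0 else if l = j then Set.Iio 0 else Set.univ)
    (fun k hk => ?_) (fun l => ?_)
  · simpa [integralFunctional_apply] using this
  · rw [integralFunctional_apply]
    simp only [torusProd_apply]
    refine hσ k ⟨i, ?_⟩ ⟨j, ?_⟩
    · simpa using hk i
    · simpa [hij.symm] using hk j
  · split_ifs with h1 h2
    · rwa [h1]
    · rwa [h2]
    · simp [fourierSpan_univ]

lemma measure_torus_ext {n : ℕ} {σ τ : Measure (Fin n → UnitAddCircle)} [IsFiniteMeasure σ]
    [IsFiniteMeasure τ]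
    (h : ∀ k : Fin n → ℤ, ∫ x, ∏ l, fourier (k l) (x l) ∂σ = ∫ x, ∏ l, fourier (k l) (x l) ∂τ) :
    σ = τ := by
  have hle : (Submodule.span ℂ (Set.range (UnitAddTorus.mFourier (d := Fin n)))).topologicalClosure ≤
      LinearMap.ker (integralFunctional σ - integralFunctional τ).toLinearMap := by
    refine Submodule.topologicalClosure_minimal _ (Submodule.span_le.mpr ?_)
      (integralFunctional σ - integralFunctional τ).isClosed_ker
    rintro _ ⟨k, rfl⟩
    exact sub_eq_zero.mpr (h k)
  rw [UnitAddTorus.span_mFourier_closure_eq_top] at hle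
  refine ext_of_forall_integral_eq_of_IsFiniteMeasure fun f => ?_
  have := hle (Submodule.mem_top (x := (⟨fun x => (f x : ℂ), by fun_prop⟩ :
    C(Fin n → UnitAddCircle, ℂ))))
  have h2 : ∫ x, (f x : ℂ) ∂σ = ∫ x, (f x : ℂ) ∂τ := sub_eq_zero.mp this
  rw [integral_complex_ofReal, integral_complex_ofReal] at h2
  exact_mod_cast h2

lemma hasSum_cauchyKernel {w : ℂ} (hw : ‖w‖ < 1) (x : UnitAddCircle) :
    HasSum (fun k : ℕ => w ^ k * fourier (-k : ℤ) x) (cauchyKernel w x) := by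
  have h : ‖w * conj (circleCoord x)‖ < 1 := by simpa using hw
  refine (hasSum_geometric_of_norm_lt_one h).congr_fun fun k => ?_
  rw [fourier_eq_circleCoord_zpow, mul_pow, conj_circleCoord, zpow_neg, zpow_natCast, inv_pow]

lemma hasSum_cauchyKernel_sub_one {w : ℂ} (hw : ‖w‖ < 1) (x : UnitAddCircle) :
    HasSum (fun k : ℕ => w ^ (k + 1) * fourier (-(k + 1 : ℕ) : ℤ) x) (cauchyKernel w x - 1) := by
  have := (hasSum_nat_add_iff' 1).mpr (hasSum_cauchyKernel hw x)
  simpa using this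

lemma hasSum_conj_circleCoord_mul_cauchyKernel_sq {w : ℂ} (hw : ‖w‖ < 1) (x : UnitAddCircle) :
    HasSum (fun k : ℕ => ((k + 1) * w ^ k) * fourier (-(k + 1 : ℕ) : ℤ) x)
      (conj (circleCoord x) * cauchyKernel w x ^ 2) := by
  have h : ‖w * conj (circleCoord x)‖ < 1 := by simpa using hw
  have := (hasSum_choose_mul_geometric_of_norm_lt_one 1 h).mul_left (conj (circleCoord x))
  rw [cauchyKernel, inv_pow, inv_eq_one_div]
  refine this.congr_fun fun k => ?_
  rw [fourier_eq_circleCoord_zpow, mul_pow, conj_circleCoord, zpow_neg, zpow_natCast, pow_succ,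
    inv_pow, mul_inv, Nat.choose_one_right]
  push_cast
  ring

lemma HasSum.conj_fourier {a : ℕ → ℂ} {p : ℕ → ℤ} {x : UnitAddCircle} {b : ℂ}
    (h : HasSum (fun k => a k * fourier (-p k) x) b) :
    HasSum (fun k => conj (a k) * fourier (p k) x) (conj b) := by
  refine h.star.congr_fun fun k => ?_
  simp only [star_mul', fourier_neg, RCLike.star_def, Complex.conj_conj]

/-- The Cauchy kernel as a continuous map. -/
noncomputable def cauchyMap (w : Metric.ball (0 : ℂ) 1) : C(UnitAddCircle, ℂ) :=
  ⟨cauchyKernel w, continuous_cauchyKernel (mem_ball_zero_iff.mp w.2)⟩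

@[simp] lemma cauchyMap_apply (w : Metric.ball (0 : ℂ) 1) (x : UnitAddCircle) :
    cauchyMap w x = cauchyKernel w x := rfl

lemma summable_norm_pow_succ {w : ℂ} (hw : ‖w‖ < 1) : Summable fun k : ℕ => ‖w ^ (k + 1)‖ := by
  simp_rw [norm_pow]
  exact (summable_nat_add_iff 1).mpr (summable_geometric_of_lt_one (norm_nonneg w) hw)

lemma summable_norm_succ_mul_pow {w : ℂ} (hw : ‖w‖ < 1) :
    Summable fun k : ℕ => ‖((k + 1) * w ^ k : ℂ)‖ := by
  have := (summable_choose_mul_geometric_of_norm_lt_one (R := ℝ) 1 (r := ‖w‖) (by simpa using hw))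
  refine this.congr fun k => ?_
  rw [norm_mul, norm_pow, Nat.choose_one_right, ← Complex.norm_natCast]
  push_cast
  rfl

lemma cauchyMap_sub_one_mem (w : Metric.ball (0 : ℂ) 1) :
    cauchyMap w - 1 ∈ fourierSpan (Set.Iio 0) :=
  mem_fourierSpan_of_hasSum (summable_norm_pow_succ (mem_ball_zero_iff.mp w.2))
    (fun k => by simp; omega) (fun x => hasSum_cauchyKernel_sub_one (mem_ball_zero_iff.mp w.2) x)

lemma star_cauchyMap_sub_one_mem (w : Metric.ball (0 : ℂ) 1) :
    star (cauchyMap w) - 1 ∈ fourierSpan (Set.Ioi 0) := by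
  refine mem_fourierSpan_of_hasSum (a := fun k => conj (w.1 ^ (k + 1)))
    (p := fun k => (k + 1 : ℕ)) ?_ (fun k => by simp) (fun x => ?_)
  · simpa using summable_norm_pow_succ (mem_ball_zero_iff.mp w.2)
  · simpa using (hasSum_cauchyKernel_sub_one (mem_ball_zero_iff.mp w.2) x).conj_fourier

/-- The function `ζ⁻¹ / (1 - w ζ⁻¹) ^ 2` on the circle. -/
noncomputable def cauchySqMap (w : Metric.ball (0 : ℂ) 1) : C(UnitAddCircle, ℂ) :=
  fourier (-1) * cauchyMap w ^ 2

lemma cauchySqMap_apply (w : Metric.ball (0 : ℂ) 1) (x : UnitAddCircle) :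
    cauchySqMap w x = conj (circleCoord x) * cauchyKernel w x ^ 2 := by
  simp [cauchySqMap, fourier_eq_circleCoord_zpow, conj_circleCoord, -fourier_apply]

lemma cauchySqMap_mem (w : Metric.ball (0 : ℂ) 1) :
    cauchySqMap w ∈ fourierSpan (Set.Iio 0) :=
  mem_fourierSpan_of_hasSum (p := fun k => (-(k + 1 : ℕ) : ℤ))
    (summable_norm_succ_mul_pow (mem_ball_zero_iff.mp w.2)) (fun k => by simp; omega) (fun x => by
      rw [cauchySqMap_apply]
      exact hasSum_conj_circleCoord_mul_cauchyKernel_sq (mem_ball_zero_iff.mp w.2) x)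

lemma star_cauchySqMap_mem (w : Metric.ball (0 : ℂ) 1) :
    star (cauchySqMap w) ∈ fourierSpan (Set.Ioi 0) := by
  refine mem_fourierSpan_of_hasSum (a := fun k => conj (((k + 1) * w.1 ^ k : ℂ)))
    (p := fun k => (k + 1 : ℕ)) ?_ (fun k => by simp) (fun x => ?_)
  · simp_rw [RCLike.norm_conj]
    exact summable_norm_succ_mul_pow (mem_ball_zero_iff.mp w.2)
  · rw [ContinuousMap.star_apply, cauchySqMap_apply]
    exact (hasSum_conj_circleCoord_mul_cauchyKernel_sq (mem_ball_zero_iff.mp w.2) x).conj_fourier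

/-- The Poisson kernel of the unit disc as a continuous map on the circle. -/
noncomputable def poissonMap (w : Metric.ball (0 : ℂ) 1) : C(UnitAddCircle, ℂ) :=
  cauchyMap w + star (cauchyMap w) - 1

lemma poissonMap_apply (w : Metric.ball (0 : ℂ) 1) (x : UnitAddCircle) :
    poissonMap w x = cauchyKernel w x + conj (cauchyKernel w x) - 1 := by
  simp [poissonMap]

lemma poissonMap_eq_ofReal (w : Metric.ball (0 : ℂ) 1) (x : UnitAddCircle) :
    poissonMap w x = (((1 - ‖w.1‖ ^ 2) * ‖cauchyKernel w x‖ ^ 2 : ℝ) : ℂ) := by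
  have hw := mem_ball_zero_iff.mp w.2
  have h1 := one_sub_mul_conj_circleCoord_ne_zero hw x
  have h2 : 1 - conj w.1 * circleCoord x ≠ 0 := by
    refine one_sub_mul_ne_zero (by simpa using hw) (by simp)
  push_cast
  rw [poissonMap_apply, ← Complex.conj_mul' w.1, ← Complex.conj_mul' (cauchyKernel w.1 x), conj_cauchyKernel, cauchyKernel]
  have hx : circleCoord x * conj (circleCoord x) = 1 := by
    rw [Complex.mul_conj, Complex.normSq_eq_norm_sq]
    simp
  field_simp
  linear_combination (-conj w.1 * w.1) * hx

lemma MixedFree.integral_prod_one_add_add {n : ℕ} {σ : Measure (Fin n → UnitAddCircle)}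
    [IsFiniteMeasure σ] (hσ : MixedFree σ) {A B : Fin n → C(UnitAddCircle, ℂ)}
    (hA : ∀ j, A j ∈ fourierSpan (Set.Iio 0)) (hB : ∀ j, B j ∈ fourierSpan (Set.Ioi 0)) :
    integralFunctional σ (torusProd fun j => 1 + A j + B j) =
      integralFunctional σ (torusProd fun j => 1 + A j) +
        integralFunctional σ (torusProd fun j => 1 + B j) - integralFunctional σ 1 := by
  set L := integralFunctional σ
  let pr : (j : Fin n) → C(UnitAddCircle, ℂ) → C(Fin n → UnitAddCircle, ℂ) :=
    fun j g => g.comp ⟨fun x => x j, continuous_apply j⟩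
  have hzero : ∀ (t u : Finset (Fin n)), u ⊆ t → t ≠ Finset.univ → u ≠ ∅ →
      L ((∏ j ∈ u, pr j (A j)) * ∏ j ∈ Finset.univ \ t, pr j (B j)) = 0 := by
    intro t u hut ht hu
    obtain ⟨i, hi⟩ := Finset.nonempty_iff_ne_empty.mpr hu
    obtain ⟨j, hj⟩ : ∃ j, j ∉ t := by
      by_contra! h
      exact ht (Finset.eq_univ_iff_forall.mpr h)
    have hju : j ∉ u := fun h => hj (hut h)
    have := hσ.integral_eq_zero (i := j) (j := i)
      (g := fun l => if l ∈ u then A l else if l ∈ t then 1 else B l)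
      (by simpa [hj, hju] using hB j) (by simpa [hi] using hA i) (fun h => hju (h ▸ hi))
    rw [← this]
    refine integral_congr_ae (Filter.Eventually.of_forall fun x => ?_)
    have : ∀ l, (if l ∈ u then A l else if l ∈ t then 1 else B l) (x l) =
        (if l ∈ u then A l (x l) else 1) * (if l ∈ Finset.univ \ t then B l (x l) else 1) := by
      intro l
      by_cases h1 : l ∈ u
      · simp [h1, hut h1]
      · by_cases h2 : l ∈ t <;> simp [h1, h2]
    simp only [this, Finset.prod_mul_distrib, Finset.prod_ite_mem, Finset.univ_inter]
    simp [pr, ContinuousMap.prod_apply]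
  have hterm : ∀ t : Finset (Fin n), t ≠ Finset.univ →
      L ((∏ j ∈ t, pr j (1 + A j)) * ∏ j ∈ Finset.univ \ t, pr j (B j)) =
        L (∏ j ∈ Finset.univ \ t, pr j (B j)) := by
    intro t ht
    have : ∏ j ∈ t, pr j (1 + A j) = ∑ u ∈ t.powerset, ∏ j ∈ u, pr j (A j) := by
      rw [← Finset.prod_one_add]
      exact Finset.prod_congr rfl fun j _ => rfl
    rw [this, Finset.sum_mul, map_sum, Finset.sum_eq_single ∅]
    · simp
    · intro u hu hne
      exact hzero t u (Finset.mem_powerset.mp hu) ht hne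
    · simp
  have h1 : torusProd (fun j => 1 + A j + B j) = ∑ t : Finset (Fin n),
      (∏ j ∈ t, pr j (1 + A j)) * ∏ j ∈ Finset.univ \ t, pr j (B j) := by
    rw [← Finset.powerset_univ, ← Finset.prod_add]
    rfl
  have h2 : torusProd (fun j => 1 + B j) = ∑ t : Finset (Fin n),
      ∏ j ∈ Finset.univ \ t, pr j (B j) := by
    rw [← Finset.powerset_univ]
    have := Finset.prod_add (fun _ => (1 : C(Fin n → UnitAddCircle, ℂ))) (fun j => pr j (B j))
      Finset.univ
    simp only [Finset.prod_const_one, one_mul] at this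
    rw [← this]
    rfl
  rw [h1, h2, map_sum, map_sum, ← Finset.add_sum_erase _ _ (Finset.mem_univ Finset.univ),
    ← Finset.add_sum_erase _ (fun t => L (∏ j ∈ Finset.univ \ t, pr j (B j)))
      (Finset.mem_univ Finset.univ),
    Finset.sum_congr rfl fun t ht => hterm t (Finset.ne_of_mem_erase ht)]
  have h3 : torusProd (fun j => 1 + A j) = ∏ j, pr j (1 + A j) := rfl
  simp only [h3, Finset.sdiff_self, Finset.prod_empty, mul_one]
  ring

lemma MixedFree.re_integral_nonneg {n : ℕ} {σ : Measure (Fin n → UnitAddCircle)}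
    [IsFiniteMeasure σ] (hσ : MixedFree σ) (w : Fin n → Metric.ball (0 : ℂ) 1) :
    0 ≤ (∫ x, (2 * ∏ j, cauchyMap (w j) (x j) - 1) ∂σ).re := by
  have h := hσ.integral_prod_one_add_add (fun j => cauchyMap_sub_one_mem (w j))
    (fun j => star_cauchyMap_sub_one_mem (w j))
  have hP : ∀ j, 1 + (cauchyMap (w j) - 1) + (star (cauchyMap (w j)) - 1) = poissonMap (w j) := by
    intro j
    rw [poissonMap]
    ring
  simp only [hP] at h
  simp only [add_sub_cancel, integralFunctional_apply, torusProd_apply,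
    ContinuousMap.star_apply, ContinuousMap.one_apply] at h
  have hconj : ∫ x, ∏ j, star (cauchyMap (w j) (x j)) ∂σ =
      conj (∫ x, ∏ j, cauchyMap (w j) (x j) ∂σ) := by
    rw [← integral_conj]
    simp [map_prod]
  have hint : Integrable (fun x => ∏ j, cauchyMap (w j) (x j)) σ := by
    simpa only [← torusProd_apply] using
      (torusProd fun j => cauchyMap (w j)).integrable_of_isFiniteMeasure σ
  rw [integral_sub (hint.const_mul 2) (integrable_const _), integral_const_mul]
  rw [hconj] at h
  have hpos : 0 ≤ (∫ x, ∏ j, poissonMap (w j) (x j) ∂σ).re := by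
    simp_rw [poissonMap_eq_ofReal, ← Complex.ofReal_prod]
    rw [integral_complex_ofReal, Complex.ofReal_re]
    refine integral_nonneg fun x => Finset.prod_nonneg fun j _ => ?_
    have := mem_ball_zero_iff.mp (w j).2
    have : ‖(w j : ℂ)‖ ^ 2 ≤ 1 := by
      rw [sq_le_one_iff₀ (norm_nonneg _)]
      exact this.le
    exact mul_nonneg (by linarith) (by positivity)
  rw [h] at hpos
  simp only [Complex.add_re, Complex.sub_re, Complex.conj_re, Complex.mul_re, Complex.re_ofNat,
    Complex.im_ofNat, zero_mul, sub_zero] at hpos ⊢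
  linarith

lemma integral_fourier_extract {n : ℕ} {σ : Measure (Fin n → UnitAddCircle)} [IsFiniteMeasure σ]
    {G : Fin n → UnitAddCircle → UnitAddCircle → ℂ} (hG : ∀ j, Continuous (Function.uncurry (G j)))
    {k : Fin n → ℤ} {c : Fin n → ℂ}
    (h : ∀ j x, ∫ u, fourier (k j) u * G j u x ∂AddCircle.haarAddCircle = c j * fourier (k j) x) :
    ∫ u : Fin n → UnitAddCircle, (∏ j, fourier (k j) (u j)) * ∫ x, ∏ j, G j (u j) (x j) ∂σ
        ∂Measure.pi (fun _ => AddCircle.haarAddCircle) =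
      (∏ j, c j) * ∫ x, ∏ j, fourier (k j) (x j) ∂σ := by
  have hc : Continuous (Function.uncurry fun (u x : Fin n → UnitAddCircle) =>
      (∏ j, fourier (k j) (u j)) * ∏ j, G j (u j) (x j)) := by
    refine Continuous.mul (by fun_prop) (continuous_finsetProd _ fun j _ => ?_)
    exact (hG j).comp (f := fun p : (Fin n → UnitAddCircle) × (Fin n → UnitAddCircle) =>
      (p.1 j, p.2 j)) (by fun_prop)
  simp_rw [← integral_const_mul]
  rw [integral_integral_swap
    (hc.integrable_of_hasCompactSupport (HasCompactSupport.of_compactSpace _))]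
  refine integral_congr_ae (Filter.Eventually.of_forall fun x => ?_)
  simp only [← Finset.prod_mul_distrib]
  rw [integral_fintype_prod_eq_prod (fun j u => fourier (k j) u * G j u (x j))]
  exact Finset.prod_congr rfl fun j _ => h j (x j)

/-- The point `ζ / 2` of the unit disc, for `ζ` on the circle. -/
noncomputable def halfPoint (u : UnitAddCircle) : Metric.ball (0 : ℂ) 1 :=
  ⟨circleCoord u / 2, by rw [mem_ball_zero_iff]; norm_num⟩

lemma norm_halfPoint (u : UnitAddCircle) : ‖(halfPoint u : ℂ)‖ < 1 :=
  mem_ball_zero_iff.mp (halfPoint u).2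

lemma continuous_uncurry_cauchyMap_halfPoint :
    Continuous (Function.uncurry fun u x => cauchyMap (halfPoint u) x) := by
  have : ∀ p : UnitAddCircle × UnitAddCircle,
      1 - (halfPoint p.1 : ℂ) * conj (circleCoord p.2) ≠ 0 :=
    fun p => one_sub_mul_conj_circleCoord_ne_zero (norm_halfPoint p.1) p.2
  refine Continuous.inv₀ ?_ this
  simp only [halfPoint]
  fun_prop

lemma cauchyMap_halfPoint_symm (u x : UnitAddCircle) :
    cauchyMap (halfPoint u) x = conj (cauchyMap (halfPoint x) u) := by
  rw [cauchyMap_apply, cauchyMap_apply, conj_cauchyKernel, cauchyKernel]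
  simp only [halfPoint, map_div₀, Complex.conj_ofNat]
  ring_nf

lemma integral_fourier_mul_cauchyMap_halfPoint {k : ℤ} (hk : k ≤ 0) (x : UnitAddCircle) :
    ∫ u, fourier k u * cauchyMap (halfPoint u) x ∂AddCircle.haarAddCircle =
      (1 / 2) ^ k.natAbs * fourier k x := by
  obtain ⟨m, rfl⟩ : ∃ m : ℕ, k = -m := ⟨k.natAbs, by omega⟩
  have h1 : DiffContOnCl ℂ (fun ζ : ℂ => ζ ^ m) (Metric.ball 0 1) :=
    Differentiable.diffContOnCl (by fun_prop)
  have := congrArg conj (integral_cauchyKernel_mul h1 (norm_halfPoint x))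
  rw [← integral_conj] at this
  simp_rw [cauchyMap_halfPoint_symm _ x, fourier_neg, ← map_mul, cauchyMap_apply]
  simp_rw [mul_comm (fourier _ _), fourier_eq_circleCoord_zpow, zpow_natCast, this]
  simp only [halfPoint, div_pow, map_div₀, map_pow, Complex.conj_ofNat, Int.natAbs_neg,
    Int.natAbs_natCast, one_pow]
  ring

lemma integral_fourier_mul_cauchyMap_halfPoint_of_pos {k : ℤ} (hk : 0 < k) (x : UnitAddCircle) :
    ∫ u, fourier k u * cauchyMap (halfPoint u) x ∂AddCircle.haarAddCircle = 0 := by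
  lift k to ℕ using hk.le
  have h1 : DiffContOnCl ℂ (fun ζ : ℂ => ζ ^ k) (Metric.ball 0 1) :=
    Differentiable.diffContOnCl (by fun_prop)
  have := integral_conj_cauchyKernel_mul h1 (norm_halfPoint x)
  simp_rw [cauchyMap_halfPoint_symm _ x, mul_comm (fourier _ _), fourier_eq_circleCoord_zpow,
    cauchyMap_apply, zpow_natCast, this]
  have : k ≠ 0 := by omega
  simp [this]

lemma integral_conj_comm_fourier {k : ℤ} {g : UnitAddCircle → ℂ} {c : ℂ} {x : UnitAddCircle}
    (h : ∫ u, fourier (-k) u * g u ∂AddCircle.haarAddCircle = c * fourier (-k) x) :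
    ∫ u, fourier k u * conj (g u) ∂AddCircle.haarAddCircle = conj c * fourier k x := by
  have := congrArg conj h
  rw [← integral_conj] at this
  simpa only [map_mul, fourier_neg, Complex.conj_conj] using this

lemma integral_fourier_mul_poissonMap_halfPoint (k : ℤ) (x : UnitAddCircle) :
    ∫ u, fourier k u * poissonMap (halfPoint u) x ∂AddCircle.haarAddCircle =
      (1 / 2) ^ k.natAbs * fourier k x := by
  have hcont : Continuous fun u => cauchyMap (halfPoint u) x :=
    continuous_uncurry_cauchyMap_halfPoint.uncurry_right x
  have hI : ∀ g : UnitAddCircle → ℂ, Continuous g → Integrable g AddCircle.haarAddCircle :=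
    fun g hg => hg.integrable_of_hasCompactSupport (HasCompactSupport.of_compactSpace _)
  have hsplit : ∫ u, fourier k u * poissonMap (halfPoint u) x ∂(AddCircle.haarAddCircle : Measure UnitAddCircle) =
      ∫ u, fourier k u * cauchyMap (halfPoint u) x ∂(AddCircle.haarAddCircle : Measure UnitAddCircle) +
      ∫ u, fourier k u * conj (cauchyMap (halfPoint u) x) ∂(AddCircle.haarAddCircle : Measure UnitAddCircle) -
      ∫ u, fourier k u ∂(AddCircle.haarAddCircle : Measure UnitAddCircle) := by
    have i1 := hI _ ((fourier k : C(UnitAddCircle, ℂ)).continuous.mul hcont)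
    have i2 := hI _ ((fourier k : C(UnitAddCircle, ℂ)).continuous.mul (Complex.continuous_conj.comp hcont))
    have key := (integral_sub (i1.add i2) (hI _ (fourier k : C(UnitAddCircle, ℂ)).continuous)).trans
      (congrArg₂ _ (integral_add i1 i2) rfl)
    refine Eq.trans (integral_congr_ae (Filter.Eventually.of_forall fun u => ?_)) key
    simp only [poissonMap_apply, cauchyMap_apply, Pi.add_apply, Pi.mul_apply, Function.comp_apply]
    ring
  rw [hsplit]
  rcases lt_trichotomy k 0 with hk | rfl | hk
  · have h2 := integral_conj_comm_fourier (k := k) (x := x) (c := 0) (by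
      rw [integral_fourier_mul_cauchyMap_halfPoint_of_pos (k := -k) (by omega) x, zero_mul])
    rw [integral_fourier_mul_cauchyMap_halfPoint hk.le, h2, integral_fourier_eq_zero hk.ne]
    simp
  · have h1 := integral_fourier_mul_cauchyMap_halfPoint (k := 0) le_rfl x
    have h2 := integral_conj_comm_fourier (k := 0) (x := x) (c := 1)
      (g := fun u => cauchyMap (halfPoint u) x) (by simpa only [neg_zero, Int.natAbs_zero, pow_zero] using h1)
    rw [h1, h2]
    simp
  · have h2 := integral_conj_comm_fourier (k := k) (x := x)
      (integral_fourier_mul_cauchyMap_halfPoint (k := -k) (by omega) x)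
    rw [integral_fourier_mul_cauchyMap_halfPoint_of_pos hk, h2, integral_fourier_eq_zero hk.ne']
    simp [Complex.conj_ofNat]

lemma integral_fourier_mul_cauchySqMap_halfPoint {k : ℤ} (hk : k < 0) (x : UnitAddCircle) :
    ∫ u, fourier k u * (circleCoord u * cauchySqMap (halfPoint u) x) ∂AddCircle.haarAddCircle =
      (k.natAbs * (1 / 2) ^ (k.natAbs - 1)) * fourier k x := by
  obtain ⟨m, rfl⟩ : ∃ m : ℕ, k = -(m + 1 : ℕ) := ⟨k.natAbs - 1, by omega⟩
  have := congrArg conj (integral_fourier_mul_cauchyKernel_sq (norm_halfPoint x) m)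
  rw [← integral_conj] at this
  have e : ∀ u, fourier (-(m + 1 : ℕ) : ℤ) u * (circleCoord u * cauchySqMap (halfPoint u) x) =
      conj (circleCoord x) * conj (fourier m u * cauchyKernel (halfPoint x) u ^ 2) := by
    intro u
    have h := cauchyMap_halfPoint_symm u x
    rw [cauchyMap_apply, cauchyMap_apply] at h
    rw [cauchySqMap_apply, h, map_mul, map_pow, ← fourier_neg, fourier_eq_circleCoord_zpow,
      fourier_eq_circleCoord_zpow]
    have : circleCoord u ≠ 0 := circleCoord_ne_zero u
    rw [zpow_neg, zpow_neg, zpow_natCast, zpow_natCast, pow_succ]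
    field_simp
  simp_rw [e]
  rw [integral_const_mul, this]
  rw [fourier_neg, fourier_eq_circleCoord_zpow, zpow_natCast]
  simp only [halfPoint, div_pow, map_div₀, map_pow, Complex.conj_ofNat, Int.natAbs_neg,
    Int.natAbs_natCast, one_pow, map_mul, map_add, map_one, map_natCast, Nat.add_sub_cancel]
  push_cast
  ring

/-- The Nevanlinna condition transported to the torus. -/
def TorusNevanlinna {n : ℕ} (σ : Measure (Fin n → UnitAddCircle)) : Prop :=
  ∀ w : Fin n → Metric.ball (0 : ℂ) 1, ∀ i j : Fin n, i < j →
    ∫ x, cauchySqMap (w i) (x i) * star (cauchySqMap (w j) (x j)) *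
      ∏ l ∈ Finset.univ \ {i, j}, poissonMap (w l) (x l) ∂σ = 0

lemma prod_ite_ite_eq {n : ℕ} {i j : Fin n} (hij : i ≠ j) (f g h : Fin n → ℂ) :
    ∏ l, (if l = i then f l else if l = j then g l else h l) =
      f i * g j * ∏ l ∈ Finset.univ \ {i, j}, h l := by
  rw [← Finset.prod_sdiff (Finset.subset_univ {i, j}), mul_comm, Finset.prod_pair hij]
  simp only [if_true, hij.symm, if_false]
  congr 1
  refine Finset.prod_congr rfl fun l hl => ?_
  simp only [Finset.mem_sdiff, Finset.mem_univ, Finset.mem_insert, Finset.mem_singleton,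
    true_and, not_or] at hl
  simp [hl.1, hl.2]

lemma MixedFree.torusNevanlinna {n : ℕ} {σ : Measure (Fin n → UnitAddCircle)} [IsFiniteMeasure σ]
    (hσ : MixedFree σ) : TorusNevanlinna σ := by
  intro w i j hij
  have := hσ.integral_eq_zero (i := j) (j := i) (g := fun l => if l = i then cauchySqMap (w l)
    else if l = j then star (cauchySqMap (w l)) else poissonMap (w l))
    (by simpa [hij.ne'] using star_cauchySqMap_mem (w j)) (by simpa using cauchySqMap_mem (w i))
    hij.ne'
  rw [← this]
  refine integral_congr_ae (Filter.Eventually.of_forall fun x => ?_)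
  dsimp only
  rw [← prod_ite_ite_eq hij.ne (fun l => cauchySqMap (w l) (x l))
    (fun l => star (cauchySqMap (w l) (x l))) (fun l => poissonMap (w l) (x l))]
  refine Finset.prod_congr rfl fun l _ => ?_
  split_ifs <;> rfl

lemma TorusNevanlinna.mixedFree {n : ℕ} {σ : Measure (Fin n → UnitAddCircle)} [IsFiniteMeasure σ]
    (hσ : TorusNevanlinna σ) : MixedFree σ := by
  have key : ∀ k : Fin n → ℤ, ∀ i j, i < j → k i < 0 → 0 < k j →
      ∫ x, ∏ l, fourier (k l) (x l) ∂σ = 0 := by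
    intro k i j hij hi hj
    have hcS : Continuous (Function.uncurry fun u x =>
        circleCoord u * cauchySqMap (halfPoint u) x) := by
      have h := continuous_uncurry_cauchyMap_halfPoint
      simp only [cauchySqMap_apply]
      exact Continuous.mul (by fun_prop) (Continuous.mul (by fun_prop) (h.pow 2))
    have hcP : Continuous (Function.uncurry fun u x => poissonMap (halfPoint u) x) := by
      have h := continuous_uncurry_cauchyMap_halfPoint
      simp only [poissonMap_apply]
      exact (h.add (Complex.continuous_conj.comp h)).sub continuous_const
    have := integral_fourier_extract (σ := σ) (k := k)
      (G := fun l u x => if l = i then circleCoord u * cauchySqMap (halfPoint u) x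
        else if l = j then conj (circleCoord u * cauchySqMap (halfPoint u) x)
        else poissonMap (halfPoint u) x)
      (c := fun l => if l = i ∨ l = j then (k l).natAbs * (1 / 2) ^ ((k l).natAbs - 1)
        else (1 / 2) ^ (k l).natAbs) (fun l => ?_) (fun l x => ?_)
    · have hzero : ∀ u : Fin n → UnitAddCircle, ∫ x : Fin n → UnitAddCircle,
          ∏ l, (if l = i then circleCoord (u l) * cauchySqMap (halfPoint (u l)) (x l)
          else if l = j then conj (circleCoord (u l) * cauchySqMap (halfPoint (u l)) (x l))
          else poissonMap (halfPoint (u l)) (x l)) ∂σ = 0 := by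
        intro u
        have h := congrArg (fun c => circleCoord (u i) * conj (circleCoord (u j)) * c)
          (hσ (fun l => halfPoint (u l)) i j hij)
        simp only [mul_zero, ← integral_const_mul] at h
        rw [← h]
        refine integral_congr_ae (Filter.Eventually.of_forall fun x => ?_)
        dsimp only
        rw [prod_ite_ite_eq hij.ne
          (fun l => circleCoord (u l) * cauchySqMap (halfPoint (u l)) (x l))
          (fun l => conj (circleCoord (u l) * cauchySqMap (halfPoint (u l)) (x l)))
          (fun l => poissonMap (halfPoint (u l)) (x l))]
        simp only [map_mul, RCLike.star_def]
        ring
      simp only [hzero, mul_zero, integral_zero] at this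
      refine (mul_eq_zero.mp this.symm).resolve_left (Finset.prod_ne_zero_iff.mpr fun l _ => ?_)
      split_ifs with h
      · have : (k l).natAbs ≠ 0 := by
          rcases h with rfl | rfl <;> omega
        exact mul_ne_zero (Nat.cast_ne_zero.mpr this) (pow_ne_zero _ (by norm_num))
      · exact pow_ne_zero _ (by norm_num)
    · by_cases h1 : l = i
      · simpa only [h1, if_true] using hcS
      · by_cases h2 : l = j
        · simpa only [h2, hij.ne', if_false, if_true] using! Complex.continuous_conj.comp hcS
        · simpa only [h1, h2, if_false] using hcP
    · by_cases h1 : l = i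
      · simpa only [h1, if_true, true_or] using integral_fourier_mul_cauchySqMap_halfPoint hi x
      · by_cases h2 : l = j
        · have := integral_conj_comm_fourier
            (integral_fourier_mul_cauchySqMap_halfPoint (k := -k j) (by omega) x)
          simpa [h2, hij.ne', Complex.conj_ofNat, -fourier_apply] using this
        · simpa only [h1, h2, if_false, or_self] using
            integral_fourier_mul_poissonMap_halfPoint (k l) x
  intro k ⟨i, hi⟩ ⟨j, hj⟩
  have hij : i ≠ j := by
    rintro rfl
    omega
  rcases hij.lt_or_gt with h | h
  · have := congrArg conj (key (-k) i j h (by simpa using hi) (by simpa using hj))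
    rw [← integral_conj] at this
    simpa only [map_prod, Pi.neg_apply, fourier_neg, Complex.conj_conj, map_zero] using this
  · exact key k j i h hj hi

lemma MixedFree.eq_of_integral_cauchyMap_eq {n : ℕ} {σ τ : Measure (Fin n → UnitAddCircle)}
    [IsFiniteMeasure σ] [IsFiniteMeasure τ] (hσ : MixedFree σ) (hτ : MixedFree τ)
    (h : ∀ w : Fin n → Metric.ball (0 : ℂ) 1,
      ∫ x, ∏ j, cauchyMap (w j) (x j) ∂σ = ∫ x, ∏ j, cauchyMap (w j) (x j) ∂τ) : σ = τ := by
  have key : ∀ k : Fin n → ℤ, (∀ j, k j ≤ 0) →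
      ∫ x, ∏ l, fourier (k l) (x l) ∂σ = ∫ x, ∏ l, fourier (k l) (x l) ∂τ := by
    intro k hk
    have e := fun (ν : Measure (Fin n → UnitAddCircle)) (hν : IsFiniteMeasure ν) =>
      integral_fourier_extract (σ := ν) (k := k)
      (G := fun _ u x => cauchyMap (halfPoint u) x) (c := fun l => (1 / 2) ^ (k l).natAbs)
      (fun _ => continuous_uncurry_cauchyMap_halfPoint)
      (fun j x => integral_fourier_mul_cauchyMap_halfPoint (hk j) x)
    have h1 := e σ inferInstance
    simp only [h] at h1
    refine mul_left_cancel₀ (Finset.prod_ne_zero_iff.mpr fun l _ => ?_)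
      (h1.symm.trans (e τ inferInstance))
    exact pow_ne_zero _ (by norm_num)
  refine measure_torus_ext fun k => ?_
  by_cases hpos : ∃ i, 0 < k i
  · by_cases hneg : ∃ j, k j < 0
    · rw [hσ k hpos hneg, hτ k hpos hneg]
    · push Not at hneg
      have := congrArg conj (key (-k) fun j => by simpa using hneg j)
      rw [← integral_conj, ← integral_conj] at this
      simpa only [map_prod, Pi.neg_apply, fourier_neg, Complex.conj_conj] using this
  · push Not at hpos
    exact key k hpos

/-- The product of the normalised Haar measures in all coordinates but the `j`-th one with the
Dirac mass at `0` in the `j`-th coordinate. -/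
noncomputable def faceMeasure {n : ℕ} (j : Fin n) : Measure (Fin n → UnitAddCircle) :=
  Measure.pi (Function.update (fun _ => AddCircle.haarAddCircle) j (Measure.dirac 0))

instance {n : ℕ} (j : Fin n) : ∀ l, IsProbabilityMeasure
    (Function.update (fun _ : Fin n => (AddCircle.haarAddCircle : Measure UnitAddCircle)) j
      (Measure.dirac 0) l) := by
  intro l
  by_cases h : l = j
  · subst h
    rw [Function.update_self]
    infer_instance
  · rw [Function.update_of_ne h]
    infer_instance

instance {n : ℕ} (j : Fin n) : IsProbabilityMeasure (faceMeasure j) := by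
  unfold faceMeasure
  infer_instance

lemma integral_faceMeasure {n : ℕ} (j : Fin n) (g : Fin n → UnitAddCircle → ℂ) :
    ∫ x, ∏ l, g l (x l) ∂(faceMeasure j) =
      g j 0 * ∏ l ∈ Finset.univ.erase j, ∫ x, g l x ∂AddCircle.haarAddCircle := by
  rw [faceMeasure, integral_fintype_prod_eq_prod, ← Finset.mul_prod_erase _ _ (Finset.mem_univ j),
    Function.update_self, integral_dirac]
  congr 1
  refine Finset.prod_congr rfl fun l hl => ?_
  rw [Function.update_of_ne (Finset.ne_of_mem_erase hl)]

lemma integral_faceMeasure_fourier {n : ℕ} (j : Fin n) (k : Fin n → ℤ) :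
    ∫ x, ∏ l, fourier (k l) (x l) ∂(faceMeasure j) = if ∃ l, l ≠ j ∧ k l ≠ 0 then 0 else 1 := by
  rw [integral_faceMeasure j fun l => fourier (k l)]
  split_ifs with h
  · obtain ⟨l, hl, hk⟩ := h
    rw [Finset.prod_eq_zero (Finset.mem_erase.mpr ⟨hl, Finset.mem_univ l⟩)
      (integral_fourier_eq_zero hk), mul_zero]
  · push Not at h
    rw [Finset.prod_eq_one, mul_one]
    · simp
    · intro l hl
      rw [h l (Finset.ne_of_mem_erase hl)]
      simp

lemma integral_faceMeasure_cauchyMap {n : ℕ} (j : Fin n) (w : Fin n → Metric.ball (0 : ℂ) 1) :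
    ∫ x, ∏ l, cauchyMap (w l) (x l) ∂(faceMeasure j) = (1 - (w j : ℂ))⁻¹ := by
  rw [integral_faceMeasure j fun l => cauchyMap (w l), Finset.prod_eq_one, mul_one]
  · simp [cauchyKernel, circleCoord_eq_one_iff.mpr]
  · intro l _
    simpa using integral_cauchyKernel_mul (h := fun _ => 1) diffContOnCl_const
      (mem_ball_zero_iff.mp (w l).2)

lemma mixedFree_faceMeasure {n : ℕ} (j : Fin n) : MixedFree (faceMeasure j) := by
  rintro k ⟨a, ha⟩ ⟨b, hb⟩
  rw [integral_faceMeasure_fourier, if_pos]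
  by_cases h : a = j
  · exact ⟨b, fun e => by subst h; subst e; omega, hb.ne⟩
  · exact ⟨a, h, ha.ne'⟩

lemma measurableSet_face {n : ℕ} (j : Fin n) :
    MeasurableSet {x : Fin n → UnitAddCircle | x j = 0} :=
  (measurable_pi_apply j) (measurableSet_singleton 0)

lemma faceMeasure_face {n : ℕ} (i j : Fin n) :
    faceMeasure i {x | x j = 0} = if i = j then 1 else 0 := by
  have : {x : Fin n → UnitAddCircle | x j = 0} =
      Set.pi Set.univ (Function.update (fun _ => Set.univ) j {0}) := by
    ext x
    simp only [Set.mem_ofPred_eq, Set.mem_univ_pi]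
    constructor
    · intro h l
      by_cases e : l = j
      · subst e
        simpa using h
      · simp [e]
    · intro h
      simpa using h j
  rw [this, faceMeasure, Measure.pi_pi, ← Finset.mul_prod_erase _ _ (Finset.mem_univ j),
    Finset.prod_eq_one, mul_one, Function.update_self]
  · split_ifs with h
    · subst h
      simp
    · rw [Function.update_of_ne (Ne.symm h), haarAddCircle_singleton]
  · intro l hl
    rw [Function.update_of_ne (Finset.ne_of_mem_erase hl)]
    exact measure_univ

/-- Radial points `1 - 1 / (m + 2)` of the unit disc, converging to `1`. -/
noncomputable def radialPoint (m : ℕ) : Metric.ball (0 : ℂ) 1 :=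
  ⟨((1 - 1 / (m + 2) : ℝ) : ℂ), by
    rw [mem_ball_zero_iff, Complex.norm_real, Real.norm_eq_abs, abs_lt]
    have : (1 : ℝ) / (m + 2) ≤ 1 := by
      rw [div_le_one (by positivity)]
      linarith [(Nat.cast_nonneg m : (0 : ℝ) ≤ m)]
    have : (0 : ℝ) < 1 / (m + 2) := by positivity
    constructor <;> linarith⟩

/-- Functions with negative spectrum approximating the indicator function of `0`. -/
noncomputable def peakMap (m : ℕ) : C(UnitAddCircle, ℂ) :=
  (1 - radialPoint m : ℂ) • (cauchyMap (radialPoint m) - 1)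

lemma peakMap_mem (m : ℕ) : peakMap m ∈ fourierSpan (Set.Iio 0) :=
  Submodule.smul_mem _ _ (cauchyMap_sub_one_mem _)

lemma peakMap_apply (m : ℕ) (x : UnitAddCircle) : peakMap m x =
    (1 - radialPoint m : ℂ) * (cauchyKernel (radialPoint m) x - 1) := rfl

lemma norm_peakMap_le (m : ℕ) (x : UnitAddCircle) : ‖peakMap m x‖ ≤ 1 := by
  set r : ℝ := 1 - 1 / (m + 2) with hr
  have hrr : (radialPoint m : ℂ) = r := rfl
  have h2 : (1 : ℝ) / (m + 2) ≤ 1 := by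
    rw [div_le_one (by positivity)]
    linarith [(Nat.cast_nonneg m : (0 : ℝ) ≤ m)]
  have h3 : (0 : ℝ) < 1 / (m + 2) := by positivity
  have hr0 : 0 ≤ r := by rw [hr]; linarith
  have hr1 : r < 1 := by rw [hr]; linarith
  have h1 := one_sub_mul_conj_circleCoord_ne_zero (mem_ball_zero_iff.mp (radialPoint m).2) x
  rw [hrr] at h1
  rw [peakMap_apply, hrr, cauchyKernel]
  have : (1 - (r : ℂ)) * ((1 - r * conj (circleCoord x))⁻¹ - 1) =
      (1 - r) * (r * conj (circleCoord x)) / (1 - r * conj (circleCoord x)) := by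
    field_simp
    ring
  rw [this, norm_div, div_le_one (norm_pos_iff.mpr h1), norm_mul, norm_mul, RCLike.norm_conj,
    norm_circleCoord, mul_one, ← Complex.ofReal_one, ← Complex.ofReal_sub, Complex.norm_real,
    Complex.norm_real, Real.norm_of_nonneg hr0, Real.norm_of_nonneg (by linarith)]
  have := norm_sub_norm_le (1 : ℂ) (r * conj (circleCoord x))
  rw [norm_mul, RCLike.norm_conj, norm_circleCoord, mul_one, norm_one, Complex.norm_real,
    Real.norm_of_nonneg hr0] at this
  rw [Complex.ofReal_one]
  nlinarith

lemma tendsto_peakMap (x : UnitAddCircle) :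
    Filter.Tendsto (fun m => peakMap m x) Filter.atTop
      (nhds (Set.indicator {0} (fun _ => 1) x)) := by
  have h0 : Filter.Tendsto (fun m : ℕ => (radialPoint m : ℂ)) Filter.atTop (nhds 1) := by
    have : Filter.Tendsto (fun m : ℕ => (1 - 1 / (m + 2) : ℝ)) Filter.atTop (nhds (1 - 0)) := by
      refine tendsto_const_nhds.sub ?_
      have := (tendsto_one_div_add_atTop_nhds_zero_nat (𝕜 := ℝ)).comp (Filter.tendsto_add_atTop_nat 1)
      refine this.congr fun m => ?_
      simp only [Function.comp_apply]
      push_cast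
      ring_nf
    rw [sub_zero] at this
    exact (Complex.continuous_ofReal.tendsto 1).comp this
  by_cases hx : x = 0
  · subst hx
    simp only [Set.mem_singleton_iff, Set.indicator_of_mem]
    refine h0.congr fun m => ?_
    have h1 := one_sub_mul_conj_circleCoord_ne_zero (mem_ball_zero_iff.mp (radialPoint m).2) 0
    rw [peakMap_apply, cauchyKernel]
    simp only [circleCoord_eq_one_iff.mpr, map_one, mul_one] at h1 ⊢
    field_simp
    ring
  · rw [Set.indicator_of_notMem (by simpa using hx)]
    have hne : 1 - 1 * conj (circleCoord x) ≠ 0 := by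
      rw [one_mul, sub_ne_zero]
      intro h
      refine hx (circleCoord_eq_one_iff.mp ?_)
      simpa using (congrArg conj h).symm
    have := (tendsto_const_nhds (x := (1 : ℂ))).sub h0 |>.mul
      ((((tendsto_const_nhds (x := (1 : ℂ))).sub
        (h0.mul_const (conj (circleCoord x)))).inv₀ hne).sub_const 1)
    rw [sub_self, zero_mul] at this
    exact this

lemma prod_ite_eq_mul {n : ℕ} (j : Fin n) (f g : Fin n → ℂ) :
    ∏ l, (if l = j then f l else g l) = f j * ∏ l ∈ Finset.univ.erase j, g l := by
  rw [← Finset.mul_prod_erase _ _ (Finset.mem_univ j), if_pos rfl]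
  congr 1
  exact Finset.prod_congr rfl fun l hl => if_neg (Finset.ne_of_mem_erase hl)

lemma setIntegral_face_eq {n : ℕ} (σ : Measure (Fin n → UnitAddCircle)) (j : Fin n)
    (k : Fin n → ℤ) : ∫ x in {x | x j = 0}, ∏ l, fourier (k l) (x l) ∂σ =
      ∫ x, ∏ l, (if l = j then Set.indicator {0} (fun _ => 1) (x l) else fourier (k l) (x l)) ∂σ := by
  rw [← integral_indicator (measurableSet_face j)]
  refine integral_congr_ae (Filter.Eventually.of_forall fun x => ?_)
  dsimp only
  rw [prod_ite_eq_mul j (fun l => Set.indicator {0} (fun _ => 1) (x l))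
    (fun l => fourier (k l) (x l))]
  by_cases hx : x j = 0
  · rw [Set.indicator_of_mem (by exact hx), Set.indicator_of_mem (by exact hx),
      ← Finset.mul_prod_erase _ _ (Finset.mem_univ j), hx]
    simp
  · rw [Set.indicator_of_notMem (by exact hx), Set.indicator_of_notMem (by exact hx), zero_mul]

lemma MixedFree.setIntegral_face_eq_zero {n : ℕ} {σ : Measure (Fin n → UnitAddCircle)}
    [IsFiniteMeasure σ] (hσ : MixedFree σ) {i j : Fin n} (hij : i ≠ j) {k : Fin n → ℤ}
    (hk : k i ≠ 0) : ∫ x in {x | x j = 0}, ∏ l, fourier (k l) (x l) ∂σ = 0 := by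
  have key : ∀ k : Fin n → ℤ, 0 < k i →
      ∫ x in {x | x j = 0}, ∏ l, fourier (k l) (x l) ∂σ = 0 := by
    intro k hk
    rw [setIntegral_face_eq]
    refine tendsto_nhds_unique (tendsto_integral_of_dominated_convergence
      (F := fun m x => ∏ l, (if l = j then peakMap m else fourier (k l)) (x l)) (fun _ => 1)
      (fun m => ?_) (integrable_const 1) (fun m => ?_) ?_) ?_
    · exact Continuous.aestronglyMeasurable (by fun_prop)
    · refine Filter.Eventually.of_forall fun x => ?_
      rw [norm_prod]
      refine Finset.prod_le_one (fun l _ => norm_nonneg _) fun l _ => ?_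
      split_ifs
      · exact norm_peakMap_le m _
      · rw [fourier_eq_circleCoord_zpow]
        simp
    · refine Filter.Eventually.of_forall fun x => tendsto_finsetProd _ fun l _ => ?_
      split_ifs
      · exact tendsto_peakMap (x l)
      · exact tendsto_const_nhds
    · refine tendsto_const_nhds.congr fun m => ?_
      refine (hσ.integral_eq_zero (i := i) (j := j) ?_ ?_ hij).symm
      · simpa [hij] using fourier_mem_fourierSpan (Set.mem_Ioi.mpr hk)
      · simpa using peakMap_mem m
  rcases hk.lt_or_gt with h | h
  · have := congrArg conj (key (-k) (by simpa using h))
    rw [← integral_conj] at this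
    simpa only [map_prod, Pi.neg_apply, fourier_neg, Complex.conj_conj, map_zero] using this
  · exact key k h

lemma MixedFree.restrict_face {n : ℕ} {σ : Measure (Fin n → UnitAddCircle)}
    [IsFiniteMeasure σ] (hσ : MixedFree σ) (j : Fin n) :
    σ.restrict {x | x j = 0} = (σ {x | x j = 0}).toNNReal • faceMeasure j := by
  refine measure_torus_ext fun k => ?_
  rw [integral_smul_nnreal_measure, integral_faceMeasure_fourier]
  split_ifs with h
  · obtain ⟨i, hij, hk⟩ := h
    rw [hσ.setIntegral_face_eq_zero hij hk, smul_zero]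
  · push Not at h
    have : ∀ x ∈ {x : Fin n → UnitAddCircle | x j = 0}, ∏ l, fourier (k l) (x l) = 1 := by
      intro x hx
      refine Finset.prod_eq_one fun l _ => ?_
      by_cases hl : l = j
      · rw [hl, show x j = 0 from hx]
        simp
      · rw [h l hl]
        simp
    rw [setIntegral_congr_fun (measurableSet_face j) this]
    simp [Measure.real, NNReal.smul_def, ENNReal.toReal]

lemma MixedFree.decomposition {n : ℕ} {σ : Measure (Fin n → UnitAddCircle)}
    [IsFiniteMeasure σ] (hσ : MixedFree σ) :
    σ = σ.restrict {x | ∀ j, x j ≠ 0} + ∑ j, (σ {x | x j = 0}).toNNReal • faceMeasure j := by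
  have hU : {x : Fin n → UnitAddCircle | ∀ j, x j ≠ 0}ᶜ = ⋃ j, {x | x j = 0} := by
    ext x
    simp
  have hd : Pairwise (Function.onFun (AEDisjoint σ) fun j => {x : Fin n → UnitAddCircle | x j = 0}) := by
    intro i j hij
    rw [Function.onFun, AEDisjoint, ← Measure.restrict_apply' (measurableSet_face j),
      hσ.restrict_face j]
    simp [faceMeasure_face, hij.symm]
  have hm : MeasurableSet {x : Fin n → UnitAddCircle | ∀ j, x j ≠ 0} := by
    rw [← MeasurableSet.compl_iff, hU]
    exact MeasurableSet.iUnion measurableSet_face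
  conv_lhs => rw [← Measure.restrict_add_restrict_compl (μ := σ) hm, hU,
    Measure.restrict_iUnion_ae hd fun j => (measurableSet_face j).nullMeasurableSet,
    Measure.sum_fintype]
  simp_rw [hσ.restrict_face]

lemma MixedFree.add {n : ℕ} {σ τ : Measure (Fin n → UnitAddCircle)} [IsFiniteMeasure σ]
    [IsFiniteMeasure τ] (hσ : MixedFree σ) (hτ : MixedFree τ) : MixedFree (σ + τ) := by
  intro k hi hj
  have hI := fun (ν : Measure (Fin n → UnitAddCircle)) (_ : IsFiniteMeasure ν) =>
    (torusProd fun l => fourier (k l)).integrable_of_isFiniteMeasure ν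
  simp only [← torusProd_apply]
  rw [integral_add_measure (hI σ inferInstance) (hI τ inferInstance)]
  have h1 := hσ k hi hj
  have h2 := hτ k hi hj
  simp only [← torusProd_apply] at h1 h2
  rw [h1, h2, add_zero]

lemma MixedFree.of_add {n : ℕ} {σ τ : Measure (Fin n → UnitAddCircle)} [IsFiniteMeasure σ]
    [IsFiniteMeasure τ] (h : MixedFree (σ + τ)) (hτ : MixedFree τ) : MixedFree σ := by
  intro k hi hj
  have hI := fun (ν : Measure (Fin n → UnitAddCircle)) (_ : IsFiniteMeasure ν) =>
    (torusProd fun l => fourier (k l)).integrable_of_isFiniteMeasure ν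
  have h1 := h k hi hj
  have h2 := hτ k hi hj
  simp only [← torusProd_apply] at h1 h2 ⊢
  rwa [integral_add_measure (hI σ inferInstance) (hI τ inferInstance), h2, add_zero] at h1

lemma mixedFree_sum_faceMeasure {n : ℕ} (b : Fin n → NNReal) :
    MixedFree (∑ j, b j • faceMeasure j) := by
  intro k hi hj
  rw [integral_finsetSum_measure fun j _ => by
    simpa only [← torusProd_apply] using ContinuousMap.integrable_of_isFiniteMeasure _ _]
  refine Finset.sum_eq_zero fun j _ => ?_
  rw [integral_smul_nnreal_measure, mixedFree_faceMeasure j k hi hj, smul_zero]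

lemma integral_sum_faceMeasure_cauchyMap {n : ℕ} (b : Fin n → NNReal)
    (w : Fin n → Metric.ball (0 : ℂ) 1) :
    ∫ x, ∏ l, cauchyMap (w l) (x l) ∂(∑ j, b j • faceMeasure j) =
      ∑ j, (b j : ℂ) * (1 - (w j : ℂ))⁻¹ := by
  rw [integral_finsetSum_measure fun j _ => by
    simpa only [← torusProd_apply] using ContinuousMap.integrable_of_isFiniteMeasure _ _]
  refine Finset.sum_congr rfl fun j _ => ?_
  rw [integral_smul_nnreal_measure, integral_faceMeasure_cauchyMap]
  rfl

lemma eq_of_add_sum_faceMeasure_eq {n : ℕ} {σ τ : Measure (Fin n → UnitAddCircle)}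
    {b c : Fin n → NNReal} (hσ : ∀ j, σ {x | x j = 0} = 0) (hτ : ∀ j, τ {x | x j = 0} = 0)
    (h : σ + ∑ j, b j • faceMeasure j = τ + ∑ j, c j • faceMeasure j) : b = c ∧ σ = τ := by
  have hface : ∀ (b : Fin n → NNReal) (j : Fin n),
      (∑ i, b i • faceMeasure i) {x : Fin n → UnitAddCircle | x j = 0} = b j := by
    intro b j
    simp [Measure.finsetSum_apply, faceMeasure_face]
  have hb : b = c := by
    funext j
    have := congrArg (fun μ => μ {x : Fin n → UnitAddCircle | x j = 0}) h
    simpa only [Measure.add_apply, hσ, hτ, hface, zero_add, ENNReal.coe_inj] using this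
  subst hb
  refine ⟨rfl, ?_⟩
  ext s hs
  have := congrArg (fun μ => μ s) h
  simp only [Measure.add_apply] at this
  exact (ENNReal.add_left_inj (measure_ne_top _ _)).mp this

/-- The open unit polydisc of `ℂⁿ`. -/
def polydisc (n : ℕ) : Set (Fin n → ℂ) := {w | ∀ k, ‖w k‖ < 1}

/-- A function of `n` complex variables is separately holomorphic on the polydisc. -/
def SeparatelyHolomorphic {n : ℕ} (f : (Fin n → ℂ) → ℂ) : Prop :=
  ∀ (j : Fin n), ∀ w ∈ polydisc n, DifferentiableAt ℂ (fun u => f (Function.update w j u)) (w j)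

lemma update_mem_polydisc {n : ℕ} {w : Fin n → ℂ} (hw : w ∈ polydisc n) (j : Fin n) {u : ℂ}
    (hu : ‖u‖ < 1) : Function.update w j u ∈ polydisc n := by
  intro k
  by_cases h : k = j
  · subst h
    simpa using hu
  · simpa [h] using hw k

lemma SeparatelyHolomorphic.differentiableAt_update {n : ℕ} {f : (Fin n → ℂ) → ℂ}
    (hf : SeparatelyHolomorphic f) {w : Fin n → ℂ} (hw : w ∈ polydisc n) (j : Fin n) {u : ℂ}
    (hu : ‖u‖ < 1) : DifferentiableAt ℂ (fun v => f (Function.update w j v)) u := by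
  simpa using hf j _ (update_mem_polydisc hw j hu)

lemma SeparatelyHolomorphic.dist_le_of_norm_le_one {n : ℕ} {g : (Fin n → ℂ) → ℂ}
    (hg : SeparatelyHolomorphic g) (hb : ∀ w ∈ polydisc n, ‖g w‖ ≤ 1) {w w₀ : Fin n → ℂ}
    (hw : w ∈ polydisc n) (hw₀ : w₀ ∈ polydisc n) (h : ∀ j, dist (w j) (w₀ j) < 1 - ‖w₀ j‖) :
    dist (g w) (g w₀) ≤ ∑ j, 2 / (1 - ‖w₀ j‖) * dist (w j) (w₀ j) := by
  classical
  have hmem : ∀ S : Finset (Fin n), S.piecewise w w₀ ∈ polydisc n := by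
    intro S k
    by_cases hk : k ∈ S
    · simpa [hk] using hw k
    · simpa [hk] using hw₀ k
  have key : ∀ S : Finset (Fin n), dist (g (S.piecewise w w₀)) (g w₀) ≤
      ∑ j ∈ S, 2 / (1 - ‖w₀ j‖) * dist (w j) (w₀ j) := by
    intro S
    induction S using Finset.induction_on with
    | empty => simp
    | insert j S hj ih =>
      rw [Finset.sum_insert hj, Finset.piecewise_insert]
      refine (dist_triangle _ (g (S.piecewise w w₀)) _).trans (add_le_add ?_ ih)
      set v := S.piecewise w w₀ with hv
      have hvj : Function.update v j (w₀ j) = v := by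
        rw [Function.update_eq_self_iff, hv, Finset.piecewise_eq_of_notMem _ _ _ hj]
      have hball : ∀ u ∈ Metric.ball (w₀ j) (1 - ‖w₀ j‖), ‖u‖ < 1 := by
        intro u hu
        rw [mem_ball_iff_norm] at hu
        linarith [norm_le_norm_add_norm_sub' u (w₀ j)]
      have := Complex.dist_le_div_mul_dist_of_mapsTo_ball (f := fun u => g (Function.update v j u))
        (c := w₀ j) (R₁ := 1 - ‖w₀ j‖) (R₂ := 2) (z := w j)
        (fun u hu => (hg.differentiableAt_update (hmem S) j (hball u hu)).differentiableWithinAt)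
        (fun u hu => ?_) (h j)
      · simpa only [hvj] using this
      · rw [mem_closedBall_iff_norm]
        refine (norm_sub_le _ _).trans ?_
        linarith [hb _ (update_mem_polydisc (hmem S) j (hball u hu)),
          hb _ (update_mem_polydisc (hmem S) j (hw₀ j))]
  simpa using key Finset.univ

lemma isOpen_polydisc (n : ℕ) : IsOpen (polydisc n) := by
  have : polydisc n = ⋂ k, {w | ‖w k‖ < 1} := by
    ext w
    simp [polydisc]
  rw [this]
  exact isOpen_iInter_of_finite fun k => isOpen_lt (by fun_prop) continuous_const

lemma SeparatelyHolomorphic.continuousOn_of_norm_le_one {n : ℕ} {g : (Fin n → ℂ) → ℂ}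
    (hg : SeparatelyHolomorphic g) (hb : ∀ w ∈ polydisc n, ‖g w‖ ≤ 1) :
    ContinuousOn g (polydisc n) := by
  intro w₀ hw₀
  refine ContinuousAt.continuousWithinAt ?_
  rw [ContinuousAt, tendsto_iff_dist_tendsto_zero]
  have hlim : Filter.Tendsto (fun w : Fin n → ℂ => ∑ j, 2 / (1 - ‖w₀ j‖) * dist (w j) (w₀ j))
      (nhds w₀) (nhds 0) := by
    have : Continuous fun w : Fin n → ℂ => ∑ j, 2 / (1 - ‖w₀ j‖) * dist (w j) (w₀ j) := by
      fun_prop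
    simpa using this.tendsto w₀
  refine squeeze_zero' (Filter.Eventually.of_forall fun _ => dist_nonneg) ?_ hlim
  have hnear : ∀ᶠ w in nhds w₀, ∀ j, dist (w j) (w₀ j) < 1 - ‖w₀ j‖ := by
    refine Filter.eventually_all.mpr fun j => ?_
    have : Continuous fun w : Fin n → ℂ => dist (w j) (w₀ j) := by fun_prop
    refine this.continuousAt.eventually_lt continuousAt_const ?_
    simpa using hw₀ j
  filter_upwards [hnear, (isOpen_polydisc n).mem_nhds hw₀] with w h1 hw
  exact hg.dist_le_of_norm_le_one hb hw hw₀ h1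

lemma SeparatelyHolomorphic.continuousOn_of_re_nonneg {n : ℕ} {f : (Fin n → ℂ) → ℂ}
    (hf : SeparatelyHolomorphic f) (hre : ∀ w ∈ polydisc n, 0 ≤ (f w).re) :
    ContinuousOn f (polydisc n) := by
  have hne : ∀ w ∈ polydisc n, f w + 1 ≠ 0 := by
    intro w hw h
    have := congrArg Complex.re h
    simp only [Complex.add_re, Complex.one_re, Complex.zero_re] at this
    linarith [hre w hw]
  have hg : ContinuousOn (fun w => (f w - 1) / (f w + 1)) (polydisc n) := by
    refine SeparatelyHolomorphic.continuousOn_of_norm_le_one (fun j w hw => ?_) fun w hw => ?_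
    · refine ((hf j w hw).sub_const 1).div ((hf j w hw).add_const 1) ?_
      simpa using hne w hw
    · rw [norm_div, div_le_one (norm_pos_iff.mpr (hne w hw)),
        ← sq_le_sq₀ (norm_nonneg _) (norm_nonneg _), ← Complex.normSq_eq_norm_sq,
        ← Complex.normSq_eq_norm_sq, Complex.normSq_apply, Complex.normSq_apply]
      simp only [Complex.sub_re, Complex.add_re, Complex.one_re, Complex.sub_im, Complex.add_im,
        Complex.one_im]
      nlinarith [hre w hw]
  have hsub : ∀ w ∈ polydisc n, 1 - (f w - 1) / (f w + 1) ≠ 0 := by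
    intro w hw
    have h1 := hne w hw
    have : 1 - (f w - 1) / (f w + 1) = 2 / (f w + 1) := by
      field_simp
      ring
    rw [this]
    exact div_ne_zero two_ne_zero h1
  have hquot : ContinuousOn (fun w => (1 + (f w - 1) / (f w + 1)) / (1 - (f w - 1) / (f w + 1)))
      (polydisc n) := (continuousOn_const.add hg).div (continuousOn_const.sub hg) hsub
  refine hquot.congr fun w hw => ?_
  have h1 := hne w hw
  have h2 := hsub w hw
  field_simp
  ring

lemma map_update_pi_prod {n : ℕ} {X : Type*} [MeasurableSpace X] (m : Measure X)
    [IsProbabilityMeasure m] (j : Fin n) :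
    ((Measure.pi fun _ : Fin n => m).prod m).map (fun p => Function.update p.1 j p.2) =
      Measure.pi fun _ : Fin n => m := by
  have hmeas : Measurable fun p : (Fin n → X) × X => Function.update p.1 j p.2 := by
    refine measurable_pi_lambda _ fun l => ?_
    by_cases h : l = j
    · subst h
      simpa using measurable_snd
    · simp only [Function.update_of_ne h]
      exact (measurable_pi_apply l).comp measurable_fst
  symm
  refine Measure.pi_eq fun s hs => ?_
  rw [Measure.map_apply hmeas (MeasurableSet.univ_pi hs)]
  have : (fun p : (Fin n → X) × X => Function.update p.1 j p.2) ⁻¹' Set.pi Set.univ s =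
      (Set.pi Set.univ (Function.update s j Set.univ)) ×ˢ s j := by
    ext p
    simp only [Set.mem_preimage, Set.mem_univ_pi, Set.mem_prod]
    constructor
    · refine fun h => ⟨fun l => ?_, by simpa using h j⟩
      by_cases e : l = j
      · subst e
        simp
      · simpa [e] using h l
    · rintro ⟨h1, h2⟩ l
      by_cases e : l = j
      · subst e
        simpa using h2
      · simpa [e] using h1 l
  rw [this, Measure.prod_prod, Measure.pi_pi, ← Finset.mul_prod_erase _ _ (Finset.mem_univ j),
    ← Finset.mul_prod_erase _ (fun l => m (s l)) (Finset.mem_univ j), Function.update_self,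
    measure_univ, one_mul, mul_comm]
  congr 1
  refine Finset.prod_congr rfl fun l hl => ?_
  rw [Function.update_of_ne (Finset.ne_of_mem_erase hl)]

lemma integral_pi_eq_integral_update {n : ℕ} {H : (Fin n → UnitAddCircle) → ℂ} (hH : Continuous H)
    (j : Fin n) :
    ∫ x, H x ∂(Measure.pi fun _ => AddCircle.haarAddCircle) =
      ∫ x : Fin n → UnitAddCircle, (∫ u, H (Function.update x j u) ∂AddCircle.haarAddCircle)
        ∂(Measure.pi fun _ => AddCircle.haarAddCircle) := by
  have hc : Continuous fun p : (Fin n → UnitAddCircle) × UnitAddCircle =>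
    Function.update p.1 j p.2 := continuous_fst.update j continuous_snd
  conv_lhs => rw [← map_update_pi_prod AddCircle.haarAddCircle j]
  rw [integral_map hc.measurable.aemeasurable hH.aestronglyMeasurable, integral_prod]
  exact (hH.comp hc).integrable_of_hasCompactSupport (HasCompactSupport.of_compactSpace _)

lemma SeparatelyHolomorphic.diffContOnCl {n : ℕ} {f : (Fin n → ℂ) → ℂ}
    (hf : SeparatelyHolomorphic f) {r : ℝ} (hr0 : 0 ≤ r) (hr : r < 1) {v : Fin n → ℂ}
    (hv : ∀ l, ‖v l‖ ≤ 1) (j : Fin n) :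
    DiffContOnCl ℂ (fun u => f fun l => r * Function.update v j u l) (Metric.ball 0 1) := by
  have hlt : ∀ u : ℂ, ‖u‖ ≤ 1 → ‖r * u‖ < 1 := by
    intro u hu
    rw [norm_mul, Complex.norm_real, Real.norm_of_nonneg hr0]
    nlinarith [norm_nonneg u]
  refine DifferentiableOn.diffContOnCl fun u hu => ?_
  rw [closure_ball _ one_ne_zero, mem_closedBall_zero_iff] at hu
  have h1 := hf.differentiableAt_update (w := fun l => r * v l) (fun l => hlt _ (hv l)) j (hlt u hu)
  have h2 := h1.comp (f := fun u : ℂ => r * u) u (by fun_prop)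
  refine DifferentiableAt.differentiableWithinAt (h2.congr_of_eventuallyEq ?_)
  refine Filter.Eventually.of_forall fun u => ?_
  simp only [Function.comp_apply]
  congr 1
  ext l
  by_cases e : l = j
  · subst e
    simp
  · simp [e]

lemma continuous_comp_mul {n : ℕ} {f : (Fin n → ℂ) → ℂ} (hf : ContinuousOn f (polydisc n)) {r : ℝ}
    (hr0 : 0 ≤ r) (hr : r < 1) {X : Type*} [TopologicalSpace X] {v : X → Fin n → ℂ}
    (hv : ∀ x l, ‖v x l‖ ≤ 1) (hc : ∀ l, Continuous fun x => v x l) :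
    Continuous fun x => f fun l => r * v x l := by
  refine hf.comp_continuous (continuous_pi fun l => continuous_const.mul (hc l)) fun x l => ?_
  rw [norm_mul, Complex.norm_real, Real.norm_of_nonneg hr0]
  nlinarith [norm_nonneg (v x l), hv x l]

lemma integral_prod_mul_separatelyHolomorphic {n : ℕ} {f : (Fin n → ℂ) → ℂ}
    (hf : SeparatelyHolomorphic f) (hfc : ContinuousOn f (polydisc n)) {r : ℝ} (hr0 : 0 ≤ r)
    (hr : r < 1) {Q : Fin n → C(UnitAddCircle, ℂ)} {p : Fin n → ℂ} (hp : ∀ l, ‖p l‖ ≤ 1)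
    (hQ : ∀ (j : Fin n) (h : ℂ → ℂ), DiffContOnCl ℂ h (Metric.ball 0 1) →
      ∫ u, Q j u * h (circleCoord u) ∂AddCircle.haarAddCircle = h (p j)) :
    ∫ x : Fin n → UnitAddCircle, (∏ l, Q l (x l)) * f (fun l => r * circleCoord (x l))
      ∂(Measure.pi fun _ => AddCircle.haarAddCircle) = f fun l => r * p l := by
  classical
  have key : ∀ S : Finset (Fin n), ∫ x : Fin n → UnitAddCircle, (∏ l ∈ S, Q l (x l)) *
      f (fun l => r * S.piecewise (fun l => circleCoord (x l)) p l)
      ∂(Measure.pi fun _ => AddCircle.haarAddCircle) = f fun l => r * p l := by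
    intro S
    induction S using Finset.induction_on with
    | empty => simp
    | insert j S hj ih =>
      have hv : ∀ (S : Finset (Fin n)) (x : Fin n → UnitAddCircle) l,
          ‖S.piecewise (fun l => circleCoord (x l)) p l‖ ≤ 1 := by
        intro S x l
        by_cases h : l ∈ S
        · simp [h]
        · simpa [h] using hp l
      have hc : ∀ (S : Finset (Fin n)) l, Continuous fun x : Fin n → UnitAddCircle =>
          S.piecewise (fun l => circleCoord (x l)) p l := by
        intro S l
        by_cases h : l ∈ S
        · simp only [h, Finset.piecewise_eq_of_mem]
          fun_prop
        · simp only [h, not_false_eq_true, Finset.piecewise_eq_of_notMem]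
          fun_prop
      have hcont : Continuous fun x : Fin n → UnitAddCircle => (∏ l ∈ insert j S, Q l (x l)) *
          f (fun l => r * (insert j S).piecewise (fun l => circleCoord (x l)) p l) :=
        Continuous.mul (by fun_prop) (continuous_comp_mul hfc hr0 hr (hv _) (hc _))
      rw [integral_pi_eq_integral_update hcont j, ← ih]
      refine integral_congr_ae (Filter.Eventually.of_forall fun x => ?_)
      dsimp only
      have hne : ∀ l ∈ S, l ≠ j := fun l hl e => hj (e ▸ hl)
      have e1 : ∀ u : UnitAddCircle, ∏ l ∈ insert j S, Q l (Function.update x j u l) =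
          (∏ l ∈ S, Q l (x l)) * Q j u := by
        intro u
        rw [Finset.prod_insert hj, Function.update_self, mul_comm]
        congr 1
        exact Finset.prod_congr rfl fun l hl => by rw [Function.update_of_ne (hne l hl)]
      have e2 : ∀ u : UnitAddCircle,
          (insert j S).piecewise (fun l => circleCoord (Function.update x j u l)) p =
          Function.update (S.piecewise (fun l => circleCoord (x l)) p) j (circleCoord u) := by
        intro u
        ext l
        by_cases e : l = j
        · subst e
          simp
        · by_cases h : l ∈ S <;> simp [e, h]
      simp_rw [e1, e2, mul_assoc]
      rw [integral_const_mul, hQ j _ (hf.diffContOnCl hr0 hr (hv S x) j)]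
      have e3 : Function.update (S.piecewise (fun l => circleCoord (x l)) p) j (p j) =
          S.piecewise (fun l => circleCoord (x l)) p := by
        rw [Function.update_eq_self_iff, Finset.piecewise_eq_of_notMem _ _ _ hj]
      rw [e3]
  simpa using key Finset.univ

lemma integral_fourier_mul_separatelyHolomorphic {n : ℕ} {f : (Fin n → ℂ) → ℂ}
    (hf : SeparatelyHolomorphic f) (hfc : ContinuousOn f (polydisc n)) {r : ℝ} (hr0 : 0 ≤ r)
    (hr : r < 1) {k : Fin n → ℤ} {j : Fin n} (hk : 0 < k j) :
    ∫ x : Fin n → UnitAddCircle, (∏ l, fourier (k l) (x l)) * f (fun l => r * circleCoord (x l))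
      ∂(Measure.pi fun _ => AddCircle.haarAddCircle) = 0 := by
  have hcont : Continuous fun x : Fin n → UnitAddCircle => (∏ l, fourier (k l) (x l)) *
      f (fun l => r * circleCoord (x l)) :=
    Continuous.mul (by fun_prop) (continuous_comp_mul hfc hr0 hr
      (v := fun (x : Fin n → UnitAddCircle) l => circleCoord (x l)) (by simp) (by fun_prop))
  rw [integral_pi_eq_integral_update hcont j]
  refine (integral_congr_ae (g := fun _ => 0) (Filter.Eventually.of_forall fun x => ?_)).trans
    (by simp)
  have e1 : ∀ u : UnitAddCircle, ∏ l, fourier (k l) (Function.update x j u l) =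
      (∏ l ∈ Finset.univ.erase j, fourier (k l) (x l)) * fourier (k j) u := by
    intro u
    rw [← Finset.mul_prod_erase _ _ (Finset.mem_univ j), Function.update_self, mul_comm]
    congr 1
    exact Finset.prod_congr rfl fun l hl => by
      rw [Function.update_of_ne (Finset.ne_of_mem_erase hl)]
  have e2 : ∀ u : UnitAddCircle, (fun l => (r : ℂ) * circleCoord (Function.update x j u l)) =
      fun l => r * Function.update (fun l => circleCoord (x l)) j (circleCoord u) l := by
    intro u
    ext l
    by_cases e : l = j
    · subst e
      simp
    · simp [e]
  simp_rw [e1, e2, mul_assoc]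
  rw [integral_const_mul, integral_fourier_mul (h := fun u => f fun l => r * Function.update
    (fun l => circleCoord (x l)) j u l) (hf.diffContOnCl hr0 hr (by simp) j) hk]
  simp

lemma integral_withDensity_re {X : Type*} [TopologicalSpace X] [CompactSpace X] [MeasurableSpace X]
    [BorelSpace X] (m : Measure X) [IsFiniteMeasure m] {φ : C(X, ℂ)} (hφ : ∀ x, 0 ≤ (φ x).re)
    (g : C(X, ℂ)) :
    ∫ x, g x ∂(m.withDensity fun x => ENNReal.ofReal (φ x).re) =
      ((∫ x, g x * φ x ∂m) + conj (∫ x, star g x * φ x ∂m)) / 2 := by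
  have hmeas : Measurable fun x => ENNReal.ofReal (φ x).re :=
    (Complex.continuous_re.comp φ.continuous).measurable.ennreal_ofReal
  rw [integral_withDensity_eq_integral_toReal_smul hmeas
    (Filter.Eventually.of_forall fun _ => ENNReal.ofReal_lt_top), ← integral_conj,
    ← integral_add (f := fun x => g x * φ x) (g := fun x => conj (star g x * φ x))
      ((g * φ).integrable_of_isFiniteMeasure m)
      ((star (star g * φ)).integrable_of_isFiniteMeasure m), ← integral_div]
  refine integral_congr_ae (Filter.Eventually.of_forall fun x => ?_)
  simp only [ENNReal.toReal_ofReal (hφ x), Complex.real_smul, ContinuousMap.star_apply,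
    RCLike.star_def, map_mul, Complex.conj_conj, Complex.re_eq_add_conj]
  ring

lemma exists_mixedFree_of_radius {n : ℕ} {f : (Fin n → ℂ) → ℂ} (hf : SeparatelyHolomorphic f)
    (hre : ∀ w ∈ polydisc n, 0 ≤ (f w).re) {r : ℝ} (hr0 : 0 ≤ r) (hr : r < 1) :
    ∃ σ : FiniteMeasure (Fin n → UnitAddCircle), MixedFree (σ : Measure (Fin n → UnitAddCircle)) ∧
      ∀ w : Fin n → Metric.ball (0 : ℂ) 1, ∫ x : Fin n → UnitAddCircle,
        ∏ j, cauchyMap (w j) (x j) ∂(σ : Measure (Fin n → UnitAddCircle)) =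
        ((f fun j => r * w j) + conj (f 0)) / 2 := by
  have hfc := hf.continuousOn_of_re_nonneg hre
  let φ : C(Fin n → UnitAddCircle, ℂ) := ⟨fun x => f fun l => r * circleCoord (x l),
    continuous_comp_mul hfc hr0 hr (v := fun (x : Fin n → UnitAddCircle) l => circleCoord (x l))
      (by simp) (by fun_prop)⟩
  have hφ : ∀ x, 0 ≤ (φ x).re := fun x => hre _ fun l => by
    rw [norm_mul, norm_circleCoord, mul_one, Complex.norm_real, Real.norm_of_nonneg hr0]
    exact hr
  set m : Measure (Fin n → UnitAddCircle) := Measure.pi fun _ => AddCircle.haarAddCircle with hm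
  have hfin : IsFiniteMeasure (m.withDensity fun x => ENNReal.ofReal (φ x).re) :=
    isFiniteMeasure_withDensity_ofReal (φ.integrable_of_isFiniteMeasure m).re.2
  refine ⟨⟨_, hfin⟩, ?_, fun w => ?_⟩
  · rintro k ⟨i, hi⟩ ⟨j, hj⟩
    have h := integral_withDensity_re m hφ (torusProd fun l => fourier (k l))
    simp only [ContinuousMap.star_apply, torusProd_apply, star_prod, RCLike.star_def,
      ← fourier_neg] at h
    refine h.trans ?_
    have h1 := integral_fourier_mul_separatelyHolomorphic hf hfc hr0 hr hi
    have h2 := integral_fourier_mul_separatelyHolomorphic hf hfc hr0 hr (k := fun l => -k l) (j := j)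
      (by simpa using hj)
    simp only [φ, ContinuousMap.coe_mk, hm]
    rw [h1, h2]
    simp
  · have h := integral_withDensity_re m hφ (torusProd fun l => cauchyMap (w l))
    simp only [ContinuousMap.star_apply, torusProd_apply, star_prod] at h
    refine h.trans ?_
    have hw := fun l => mem_ball_zero_iff.mp (w l).2
    have h1 := integral_prod_mul_separatelyHolomorphic hf hfc hr0 hr (Q := fun l => cauchyMap (w l))
      (p := fun l => w l) (fun l => (hw l).le) (fun l h hh => integral_cauchyKernel_mul hh (hw l))
    have h2 := integral_prod_mul_separatelyHolomorphic hf hfc hr0 hr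
      (Q := fun l => star (cauchyMap (w l))) (p := fun _ => 0) (by simp)
      (fun l h hh => integral_conj_cauchyKernel_mul hh (hw l))
    simp only [ContinuousMap.star_apply, mul_zero] at h2
    simp only [φ, ContinuousMap.coe_mk, hm]
    rw [h1, h2]
    rfl

theorem exists_mixedFree_measure {n : ℕ} {f : (Fin n → ℂ) → ℂ} (hf : SeparatelyHolomorphic f)
    (hre : ∀ w ∈ polydisc n, 0 ≤ (f w).re) :
    ∃ σ : Measure (Fin n → UnitAddCircle), IsFiniteMeasure σ ∧ MixedFree σ ∧
      ∀ w : Fin n → Metric.ball (0 : ℂ) 1, (f fun j => w j) =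
        Complex.I * (f 0).im + ∫ x, (2 * ∏ j, cauchyMap (w j) (x j) - 1) ∂σ := by
  have hfc := hf.continuousOn_of_re_nonneg hre
  have hr0 : ∀ m : ℕ, (0 : ℝ) ≤ 1 - 1 / (m + 2) := fun m => by
    rw [sub_nonneg, div_le_one (by positivity)]
    linarith [(Nat.cast_nonneg m : (0 : ℝ) ≤ m)]
  have hr1 : ∀ m : ℕ, 1 - 1 / (m + 2) < (1 : ℝ) := fun m => by
    have : (0 : ℝ) < 1 / (m + 2) := by positivity
    linarith
  have hrlim : Filter.Tendsto (fun m : ℕ => (1 - 1 / (m + 2) : ℝ)) Filter.atTop (nhds 1) := by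
    have h := ((tendsto_one_div_add_atTop_nhds_zero_nat (𝕜 := ℝ)).comp
      (Filter.tendsto_add_atTop_nat 1)).const_sub 1
    rw [sub_zero] at h
    refine h.congr fun m => ?_
    simp only [Function.comp_apply]
    push_cast
    ring
  choose σ hσ hw using fun m => exists_mixedFree_of_radius hf hre (hr0 m) (hr1 m)
  have hone : ∀ (ν : Measure (Fin n → UnitAddCircle)),
      ∫ x, ∏ j, cauchyMap ((fun _ => ⟨0, by simp⟩ : Fin n → Metric.ball (0 : ℂ) 1) j) (x j) ∂ν =
        (ν.real Set.univ : ℂ) := by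
    intro ν
    simp [cauchyKernel]
  have hmass : ∀ m, (σ m).mass ≤ (f 0).re.toNNReal := by
    intro m
    have h := hw m fun _ => ⟨0, by simp⟩
    rw [hone] at h
    have h0 : (fun _ : Fin n => (((1 - 1 / (m + 2) : ℝ) : ℂ)) * 0) = 0 := by
      ext
      simp
    simp only [h0, ← Complex.re_eq_add_conj] at h
    refine le_of_eq (NNReal.eq ?_)
    rw [Real.coe_toNNReal _ (hre 0 (fun _ => by simp)), ← Complex.ofReal_inj.mp h]
    rfl
  obtain ⟨τ, -, hτ⟩ := (isCompact_setOfPred_finiteMeasure_le_of_compactSpace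
    (Fin n → UnitAddCircle) (f 0).re.toNNReal).ultrafilter_le_nhds'
    ((Filter.hyperfilter ℕ).map σ) (Ultrafilter.mem_map.mpr (Filter.univ_mem' hmass))
  have hlim : ∀ g : C(Fin n → UnitAddCircle, ℂ), Filter.Tendsto (fun m => ∫ x, g x ∂(σ m : Measure _))
      (Filter.hyperfilter ℕ) (nhds (∫ x, g x ∂(τ : Measure _))) := fun g =>
    (FiniteMeasure.tendsto_iff_forall_integral_rclike_tendsto ℂ).mp hτ
      (BoundedContinuousFunction.mkOfCompact g)
  have hle : (Filter.hyperfilter ℕ : Filter ℕ) ≤ Filter.atTop := by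
    rw [← Nat.cofinite_eq_atTop]
    exact Filter.hyperfilter_le_cofinite
  have key : ∀ w : Fin n → Metric.ball (0 : ℂ) 1,
      ∫ x : Fin n → UnitAddCircle, ∏ j, cauchyMap (w j) (x j)
        ∂(τ : Measure (Fin n → UnitAddCircle)) = ((f fun j => w j) + conj (f 0)) / 2 := by
    intro w
    have h := hlim (torusProd fun l => cauchyMap (w l))
    simp only [torusProd_apply, hw] at h
    refine tendsto_nhds_unique h (Filter.Tendsto.mono_left ?_ hle)
    refine (Filter.Tendsto.add_const _ ?_).div_const 2
    have hmem : (fun j => (w j : ℂ)) ∈ polydisc n := fun l => mem_ball_zero_iff.mp (w l).2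
    refine (hfc.continuousAt ((isOpen_polydisc n).mem_nhds hmem)).tendsto.comp ?_
    refine tendsto_pi_nhds.mpr fun j => ?_
    simpa using ((Complex.continuous_ofReal.tendsto 1).comp hrlim).mul_const (w j : ℂ)
  refine ⟨τ, inferInstance, ?_, fun w => ?_⟩
  · intro k hi hj
    have h := hlim (torusProd fun l => fourier (k l))
    simp only [torusProd_apply, hσ _ k hi hj] at h
    exact tendsto_nhds_unique h tendsto_const_nhds
  · have h1 := key fun _ => ⟨0, by simp⟩
    rw [hone] at h1
    have hI : Integrable (fun x : Fin n → UnitAddCircle => ∏ j, cauchyMap (w j) (x j))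
        (τ : Measure (Fin n → UnitAddCircle)) := by
      simp only [← torusProd_apply]
      exact ContinuousMap.integrable_of_isFiniteMeasure _ _
    rw [integral_sub (hI.const_mul 2) (integrable_const _), integral_const_mul, key w,
      integral_const, Complex.real_smul, h1]
    have h2 : (fun _ : Fin n => (0 : ℂ)) = 0 := rfl
    rw [h2, ← Complex.re_eq_add_conj]
    apply Complex.ext <;> simp <;> ring

/-- The Cayley transform from the upper half-plane to the disc. -/
noncomputable def cayley (z : ℂ) : ℂ := (z - Complex.I) / (z + Complex.I)

/-- The inverse Cayley transform. -/
noncomputable def cayleySymm (w : ℂ) : ℂ := Complex.I * (1 + w) / (1 - w)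

lemma add_I_ne_zero {z : ℂ} (hz : 0 ≤ z.im) : z + Complex.I ≠ 0 := by
  intro h
  have := congrArg Complex.im h
  simp at this
  linarith

lemma ofReal_sub_I_ne_zero (t : ℝ) : (t : ℂ) - Complex.I ≠ 0 := by
  intro h
  simpa using congrArg Complex.im h

lemma ofReal_sub_ne_zero (t : ℝ) {z : ℂ} (hz : z.im ≠ 0) : (t : ℂ) - z ≠ 0 := by
  intro h
  have := congrArg Complex.im h
  simp at this
  exact hz this

lemma one_sub_ne_zero_of_norm_lt_one {w : ℂ} (hw : ‖w‖ < 1) : 1 - w ≠ 0 := by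
  simpa using one_sub_mul_ne_zero hw (u := 1) (by simp)

lemma norm_cayley_lt_one {z : ℂ} (hz : 0 < z.im) : ‖cayley z‖ < 1 := by
  rw [cayley, norm_div, div_lt_one (norm_pos_iff.mpr (add_I_ne_zero hz.le)),
    ← sq_lt_sq₀ (norm_nonneg _) (norm_nonneg _), ← Complex.normSq_eq_norm_sq,
    ← Complex.normSq_eq_norm_sq, Complex.normSq_apply, Complex.normSq_apply]
  simp
  nlinarith

lemma im_cayleySymm_pos {w : ℂ} (hw : ‖w‖ < 1) : 0 < (cayleySymm w).im := by
  have h1 := one_sub_ne_zero_of_norm_lt_one hw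
  have h2 : cayleySymm w = Complex.I * ((1 + w) * conj (1 - w)) / (Complex.normSq (1 - w) : ℝ) := by
    rw [← Complex.mul_conj, cayleySymm]
    have h3 : conj (1 - w) ≠ 0 := (map_ne_zero _).mpr h1
    field_simp
  have h3 : 0 < Complex.normSq (1 - w) := Complex.normSq_pos.mpr h1
  have h4 : w.re * w.re + w.im * w.im < 1 := by
    rw [← Complex.normSq_apply, Complex.normSq_eq_norm_sq]
    nlinarith [norm_nonneg w]
  rw [h2, Complex.div_ofReal_im]
  refine div_pos ?_ h3
  simp
  nlinarith

lemma cayleySymm_cayley {z : ℂ} (hz : 0 ≤ z.im) : cayleySymm (cayley z) = z := by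
  have h := add_I_ne_zero hz
  have h2 : 1 - (z - Complex.I) / (z + Complex.I) = 2 * Complex.I / (z + Complex.I) := by
    field_simp
    ring
  rw [cayleySymm, cayley, h2]
  have := Complex.I_ne_zero
  field_simp
  ring

lemma cayley_cayleySymm {w : ℂ} (hw : 1 - w ≠ 0) : cayley (cayleySymm w) = w := by
  have h2 : Complex.I * (1 + w) / (1 - w) + Complex.I = 2 * Complex.I / (1 - w) := by
    field_simp
    ring
  rw [cayley, cayleySymm, h2]
  have := Complex.I_ne_zero
  field_simp
  ring

lemma norm_cayley_ofReal (t : ℝ) : ‖cayley t‖ = 1 := by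
  have h : (t : ℂ) - Complex.I = conj ((t : ℂ) + Complex.I) := by simp [sub_eq_add_neg]
  rw [cayley, norm_div, h, RCLike.norm_conj, div_self]
  exact norm_ne_zero_iff.mpr (add_I_ne_zero (by simp))

/-- The Cayley transform from the real line to the circle. -/
noncomputable def realCayley (t : ℝ) : UnitAddCircle :=
  (AddCircle.homeomorphCircle one_ne_zero).symm
    ⟨cayley t, mem_sphere_zero_iff_norm.mpr (norm_cayley_ofReal t)⟩

@[simp] lemma circleCoord_realCayley (t : ℝ) : circleCoord (realCayley t) = cayley t := by
  rw [circleCoord, ← AddCircle.homeomorphCircle_apply one_ne_zero]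
  exact congrArg Subtype.val ((AddCircle.homeomorphCircle one_ne_zero).apply_symm_apply _)

lemma continuous_realCayley : Continuous realCayley := by
  refine (AddCircle.homeomorphCircle one_ne_zero).symm.continuous.comp ?_
  refine Continuous.subtype_mk ?_ _
  exact Continuous.div (by fun_prop) (by fun_prop) fun t => add_I_ne_zero (by simp)

lemma realCayley_ne_zero (t : ℝ) : realCayley t ≠ 0 := by
  rw [ne_eq, ← circleCoord_eq_one_iff, circleCoord_realCayley, cayley, div_eq_one_iff_eq
    (add_I_ne_zero (by simp))]
  intro h
  have := congrArg Complex.im h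
  simp at this
  norm_num at this

/-- The inverse Cayley transform from the circle to the real line. -/
noncomputable def realCayleySymm (x : UnitAddCircle) : ℝ := (cayleySymm (circleCoord x)).re

lemma measurable_realCayleySymm : Measurable realCayleySymm := by
  have := continuous_circleCoord.measurable
  unfold realCayleySymm cayleySymm
  fun_prop

lemma realCayleySymm_realCayley (t : ℝ) : realCayleySymm (realCayley t) = t := by
  rw [realCayleySymm, circleCoord_realCayley, cayleySymm_cayley (by simp), Complex.ofReal_re]

lemma circleCoord_injective : Function.Injective circleCoord := fun _ _ h =>
  AddCircle.injective_toCircle one_ne_zero (Circle.ext h)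

lemma realCayley_realCayleySymm {x : UnitAddCircle} (hx : x ≠ 0) :
    realCayley (realCayleySymm x) = x := by
  have h1 : 1 - circleCoord x ≠ 0 := sub_ne_zero.mpr fun h => hx (circleCoord_eq_one_iff.mp h.symm)
  have h3 : circleCoord x - 1 ≠ 0 := by rwa [← neg_ne_zero, neg_sub]
  have h0 := circleCoord_ne_zero x
  have h2 : ((cayleySymm (circleCoord x)).re : ℂ) = cayleySymm (circleCoord x) := by
    rw [← Complex.conj_eq_iff_re]
    simp only [cayleySymm, map_div₀, map_mul, map_add, map_sub, map_one, Complex.conj_I,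
      conj_circleCoord]
    field_simp
    ring
  refine circleCoord_injective ?_
  rw [circleCoord_realCayley, realCayleySymm, h2, cayley_cayleySymm h1]

lemma ofReal_one_add_sq (t : ℝ) : ((1 + t ^ 2 : ℝ) : ℂ) = (t - Complex.I) * (t + Complex.I) := by
  push_cast
  ring_nf
  simp
  ring

lemma cauchyKernel_realCayley {z : ℂ} (hz : 0 < z.im) (t : ℝ) : cauchyKernel (cayley z) (realCayley t) =
    (z + Complex.I) * (t - Complex.I) / (2 * Complex.I * (t - z)) := by
  have h1 := ofReal_sub_I_ne_zero t
  have h2 := add_I_ne_zero hz.le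
  have h3 := ofReal_sub_ne_zero t hz.ne'
  have h4 := add_I_ne_zero (z := t) (by simp)
  have hI := Complex.I_ne_zero
  have h5 : 1 - cayley z * (cayley t)⁻¹ = 2 * Complex.I * (t - z) / ((z + Complex.I) * (t - Complex.I)) := by
    rw [cayley, cayley]
    field_simp
    ring
  rw [cauchyKernel, conj_circleCoord, circleCoord_realCayley, h5, inv_div]

lemma one_div_sub_sub_one_div_add_I {z : ℂ} (hz : 0 < z.im) (t : ℝ) :
    1 / ((t : ℂ) - z) - 1 / ((t : ℂ) + Complex.I) =
      2 * Complex.I * ((1 / (1 + t ^ 2) : ℝ) * cauchyKernel (cayley z) (realCayley t)) := by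
  rw [Complex.ofReal_div, ofReal_one_add_sq, cauchyKernel_realCayley hz]
  have h1 := ofReal_sub_I_ne_zero t
  have h3 := ofReal_sub_ne_zero t hz.ne'
  have h4 := add_I_ne_zero (z := t) (by simp)
  have hI := Complex.I_ne_zero
  push_cast
  field_simp
  ring

lemma one_div_sub_I_sub_one_div_add_I (t : ℝ) :
    1 / ((t : ℂ) - Complex.I) - 1 / ((t : ℂ) + Complex.I) = 2 * Complex.I * (1 / (1 + t ^ 2) : ℝ) := by
  rw [Complex.ofReal_div, ofReal_one_add_sq]
  have h1 := ofReal_sub_I_ne_zero t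
  have h4 := add_I_ne_zero (z := t) (by simp)
  push_cast
  field_simp
  ring

lemma sub_sq_inv_eq {z : ℂ} (hz : 0 < z.im) (t : ℝ) : (((t : ℂ) - z) ^ 2)⁻¹ =
    (-4 / (z + Complex.I) ^ 2) * ((1 / (1 + t ^ 2) : ℝ) *
      (conj (circleCoord (realCayley t)) * cauchyKernel (cayley z) (realCayley t) ^ 2)) := by
  rw [Complex.ofReal_div, ofReal_one_add_sq, cauchyKernel_realCayley hz, conj_circleCoord,
    circleCoord_realCayley, cayley]
  have h1 := ofReal_sub_I_ne_zero t
  have h2 := add_I_ne_zero hz.le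
  have h3 := ofReal_sub_ne_zero t hz.ne'
  have h4 := add_I_ne_zero (z := t) (by simp)
  have hI := Complex.I_ne_zero
  push_cast
  field_simp
  norm_num

lemma one_div_sub_sub_one_div_sub_conj {z : ℂ} (hz : 0 < z.im) (t : ℝ) :
    1 / ((t : ℂ) - z) - 1 / ((t : ℂ) - conj z) = 2 * Complex.I * ((1 / (1 + t ^ 2) : ℝ) *
      (cauchyKernel (cayley z) (realCayley t) + conj (cauchyKernel (cayley z) (realCayley t)) - 1)) := by
  have h1 := one_div_sub_sub_one_div_add_I hz t
  have h2 := congrArg conj h1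
  have h3 := one_div_sub_I_sub_one_div_add_I t
  simp only [map_sub, map_mul, map_div₀, map_add, map_one, Complex.conj_ofReal, Complex.conj_I,
    Complex.conj_ofNat] at h2
  linear_combination h1 - h2 - h3

/-- The density `∏ 1 / (π (1 + t_j²))`. -/
noncomputable def cauchyWeight {n : ℕ} (t : Fin n → ℝ) : ℝ := ∏ j, (Real.pi * (1 + t j ^ 2))⁻¹

lemma cauchyWeight_pos {n : ℕ} (t : Fin n → ℝ) : 0 < cauchyWeight t :=
  Finset.prod_pos fun j _ => inv_pos.mpr (mul_pos Real.pi_pos (by positivity))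

lemma measurable_cauchyWeight {n : ℕ} : Measurable (cauchyWeight : (Fin n → ℝ) → ℝ) := by
  unfold cauchyWeight
  fun_prop

lemma measurable_ofReal_cauchyWeight {n : ℕ} :
    Measurable fun t : Fin n → ℝ => ENNReal.ofReal (cauchyWeight t) :=
  measurable_cauchyWeight.ennreal_ofReal

lemma ofReal_cauchyWeight_ne_zero {n : ℕ} (t : Fin n → ℝ) : ENNReal.ofReal (cauchyWeight t) ≠ 0 := by
  simpa using cauchyWeight_pos t

lemma cauchyWeight_eq {n : ℕ} (t : Fin n → ℝ) :
    (cauchyWeight t : ℂ) = (1 / (Real.pi : ℂ) ^ n) * ∏ j, ((1 / (1 + t j ^ 2) : ℝ) : ℂ) := by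
  rw [cauchyWeight, Complex.ofReal_prod]
  simp only [mul_inv, Complex.ofReal_mul, Finset.prod_mul_distrib]
  simp

/-- The Cayley transform, coordinatewise. -/
noncomputable def torusCayley {n : ℕ} (t : Fin n → ℝ) : Fin n → UnitAddCircle :=
  fun j => realCayley (t j)

/-- The inverse Cayley transform, coordinatewise. -/
noncomputable def torusCayleySymm {n : ℕ} (x : Fin n → UnitAddCircle) : Fin n → ℝ :=
  fun j => realCayleySymm (x j)

lemma measurable_torusCayley {n : ℕ} : Measurable (torusCayley (n := n)) :=
  measurable_pi_lambda _ fun j => continuous_realCayley.measurable.comp (measurable_pi_apply j)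

lemma measurable_torusCayleySymm {n : ℕ} : Measurable (torusCayleySymm (n := n)) :=
  measurable_pi_lambda _ fun j => measurable_realCayleySymm.comp (measurable_pi_apply j)

/-- The measure on the torus corresponding to a measure on `ℝⁿ`. -/
noncomputable def toTorus {n : ℕ} (μ : Measure (Fin n → ℝ)) : Measure (Fin n → UnitAddCircle) :=
  (μ.withDensity fun t => ENNReal.ofReal (cauchyWeight t)).map torusCayley

/-- The measure on `ℝⁿ` corresponding to a measure on the torus. -/
noncomputable def ofTorus {n : ℕ} (σ : Measure (Fin n → UnitAddCircle)) : Measure (Fin n → ℝ) :=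
  (σ.map torusCayleySymm).withDensity fun t => (ENNReal.ofReal (cauchyWeight t))⁻¹

lemma ofTorus_toTorus {n : ℕ} (μ : Measure (Fin n → ℝ)) : ofTorus (toTorus μ) = μ := by
  have h : torusCayleySymm ∘ torusCayley = (id : (Fin n → ℝ) → Fin n → ℝ) := by
    ext t j
    exact realCayleySymm_realCayley (t j)
  rw [ofTorus, toTorus, Measure.map_map measurable_torusCayleySymm measurable_torusCayley, h,
    Measure.map_id, withDensity_inv_same measurable_ofReal_cauchyWeight
      (Filter.Eventually.of_forall ofReal_cauchyWeight_ne_zero)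
      (Filter.Eventually.of_forall fun _ => ENNReal.ofReal_ne_top)]

lemma toTorus_ofTorus {n : ℕ} {σ : Measure (Fin n → UnitAddCircle)}
    (hσ : ∀ j, σ {x | x j = 0} = 0) : toTorus (ofTorus σ) = σ := by
  have h := withDensity_inv_same (μ := σ.map torusCayleySymm)
    (f := fun t : Fin n → ℝ => (ENNReal.ofReal (cauchyWeight t))⁻¹)
    measurable_ofReal_cauchyWeight.inv (Filter.Eventually.of_forall fun t => by simp)
    (Filter.Eventually.of_forall fun t => by simpa using cauchyWeight_pos t)
  simp only [inv_inv] at h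
  rw [toTorus, ofTorus, h, Measure.map_map measurable_torusCayley measurable_torusCayleySymm]
  have hae : torusCayley ∘ torusCayleySymm =ᵐ[σ] (id : (Fin n → UnitAddCircle) → _) := by
    have : ∀ᵐ x ∂σ, ∀ j, x j ≠ 0 := ae_all_iff.mpr fun j => by
      rw [ae_iff]
      simpa using hσ j
    filter_upwards [this] with x hx
    ext j
    exact realCayley_realCayleySymm (hx j)
  rw [Measure.map_congr hae, Measure.map_id]

lemma toTorus_face {n : ℕ} (μ : Measure (Fin n → ℝ)) (j : Fin n) : toTorus μ {x | x j = 0} = 0 := by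
  rw [toTorus, Measure.map_apply measurable_torusCayley (measurableSet_face j)]
  have : torusCayley ⁻¹' {x : Fin n → UnitAddCircle | x j = 0} = ∅ :=
    Set.eq_empty_of_forall_notMem fun t => realCayley_ne_zero (t j)
  rw [this, measure_empty]

lemma integral_toTorus {n : ℕ} (μ : Measure (Fin n → ℝ)) {g : (Fin n → UnitAddCircle) → ℂ}
    (hg : Continuous g) :
    ∫ x, g x ∂(toTorus μ) = ∫ t, (cauchyWeight t : ℂ) * g (torusCayley t) ∂μ := by
  rw [toTorus, integral_map measurable_torusCayley.aemeasurable hg.aestronglyMeasurable,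
    integral_withDensity_eq_integral_toReal_smul measurable_ofReal_cauchyWeight
      (Filter.Eventually.of_forall fun _ => ENNReal.ofReal_lt_top)]
  refine integral_congr_ae (Filter.Eventually.of_forall fun t => ?_)
  simp only [ENNReal.toReal_ofReal (cauchyWeight_pos t).le, Complex.real_smul]

lemma herglotzGrowthCondition_iff {n : ℕ} {μ : Measure (Fin n → ℝ)} :
    HerglotzGrowthCondition n μ ↔ IsFiniteMeasure (toTorus μ) := by
  have h : ∀ t : Fin n → ℝ, ∏ l, ENNReal.ofReal (1 / (1 + t l ^ 2)) =
      ENNReal.ofReal (Real.pi ^ n) * ENNReal.ofReal (cauchyWeight t) := by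
    intro t
    rw [← ENNReal.ofReal_prod_of_nonneg (fun l _ => by positivity),
      ← ENNReal.ofReal_mul (by positivity), cauchyWeight]
    congr 1
    simp only [mul_inv, Finset.prod_mul_distrib, Finset.prod_const, Finset.card_univ,
      Fintype.card_fin, one_div]
    rw [inv_pow, mul_inv_cancel_left₀ (by positivity)]
  have huniv : toTorus μ Set.univ = ∫⁻ t, ENNReal.ofReal (cauchyWeight t) ∂μ := by
    rw [toTorus, Measure.map_apply measurable_torusCayley MeasurableSet.univ, Set.preimage_univ,
      withDensity_apply _ MeasurableSet.univ, Measure.restrict_univ]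
  rw [HerglotzGrowthCondition, isFiniteMeasure_iff, huniv]
  simp_rw [h]
  rw [lintegral_const_mul _ measurable_ofReal_cauchyWeight, ENNReal.mul_lt_top_iff]
  have h0 : ENNReal.ofReal (Real.pi ^ n) ≠ 0 := by simpa using by positivity
  constructor
  · rintro (h | h | h)
    · exact h.2
    · exact absurd h h0
    · simp [h]
  · exact fun h => Or.inl ⟨ENNReal.ofReal_lt_top, h⟩

/-- The image of a point of the upper half-plane under the Cayley transform. -/
noncomputable def cayleyBall (z : ℂ) (hz : 0 < z.im) : Metric.ball (0 : ℂ) 1 :=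
  ⟨cayley z, mem_ball_zero_iff.mpr (norm_cayley_lt_one hz)⟩

lemma herglotzKernel_eq {n : ℕ} {z : Fin n → ℂ} (hz : ∀ k, 0 < (z k).im) (t : Fin n → ℝ) :
    (1 / (Real.pi : ℂ) ^ n) * herglotzKernel n z t = (cauchyWeight t : ℂ) * (Complex.I *
      (2 * ∏ j, cauchyMap (cayleyBall (z j) (hz j)) (torusCayley t j) - 1)) := by
  have hI := Complex.I_ne_zero
  simp only [herglotzKernel, one_div_sub_I_sub_one_div_add_I]
  simp_rw [fun j => one_div_sub_sub_one_div_add_I (hz j) (t j)]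
  simp only [Finset.prod_mul_distrib, Finset.prod_const, Finset.card_univ, Fintype.card_fin,
    cauchyWeight_eq, cauchyMap_apply, cayleyBall, torusCayley, mul_pow]
  field_simp

lemma integral_herglotzKernel {n : ℕ} (μ : Measure (Fin n → ℝ)) {z : Fin n → ℂ}
    (hz : ∀ k, 0 < (z k).im) :
    (1 / (Real.pi : ℂ) ^ n) * ∫ t, herglotzKernel n z t ∂μ = Complex.I *
      ∫ x, (2 * ∏ j, cauchyMap (cayleyBall (z j) (hz j)) (x j) - 1) ∂(toTorus μ) := by
  rw [← integral_const_mul, ← integral_const_mul, integral_toTorus μ (by fun_prop)]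
  simp_rw [herglotzKernel_eq hz]

lemma nevanlinna_integrand_eq {n : ℕ} {z : Fin n → ℂ} (hz : ∀ k, 0 < (z k).im) (t : Fin n → ℝ)
    {i j : Fin n} (hij : i ≠ j) :
    (((t i : ℂ) - z i) ^ 2)⁻¹ * (((t j : ℂ) - conj (z j)) ^ 2)⁻¹ *
        ∏ l ∈ Finset.univ \ {i, j}, (1 / ((t l : ℂ) - z l) - 1 / ((t l : ℂ) - conj (z l))) =
      ((-4 / (z i + Complex.I) ^ 2) * conj (-4 / (z j + Complex.I) ^ 2) *
        (2 * Complex.I) ^ (Finset.univ \ {i, j} : Finset (Fin n)).card * (Real.pi : ℂ) ^ n) *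
      ((cauchyWeight t : ℂ) * (cauchySqMap (cayleyBall (z i) (hz i)) (torusCayley t i) *
        star (cauchySqMap (cayleyBall (z j) (hz j)) (torusCayley t j)) *
        ∏ l ∈ Finset.univ \ {i, j}, poissonMap (cayleyBall (z l) (hz l)) (torusCayley t l))) := by
  have h1 : ∀ l, (((t l : ℂ) - z l) ^ 2)⁻¹ = (-4 / (z l + Complex.I) ^ 2) *
      (((1 / (1 + t l ^ 2) : ℝ) : ℂ) *
        cauchySqMap (cayleyBall (z l) (hz l)) (torusCayley t l)) := fun l => by
    rw [sub_sq_inv_eq (hz l), cauchySqMap_apply]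
    rfl
  have h2 := congrArg conj (h1 j)
  rw [map_inv₀, map_pow, map_sub, Complex.conj_ofReal, map_mul, map_mul, Complex.conj_ofReal] at h2
  have h3 : ∏ l ∈ Finset.univ \ {i, j}, (1 / ((t l : ℂ) - z l) - 1 / ((t l : ℂ) - conj (z l))) =
      (2 * Complex.I) ^ (Finset.univ \ {i, j} : Finset (Fin n)).card *
        ((∏ l ∈ Finset.univ \ {i, j}, ((1 / (1 + t l ^ 2) : ℝ) : ℂ)) *
          ∏ l ∈ Finset.univ \ {i, j}, poissonMap (cayleyBall (z l) (hz l)) (torusCayley t l)) := by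
    rw [← Finset.prod_const, ← Finset.prod_mul_distrib, ← Finset.prod_mul_distrib]
    refine Finset.prod_congr rfl fun l _ => ?_
    rw [one_div_sub_sub_one_div_sub_conj (hz l), poissonMap_apply]
    rfl
  have hw : ∏ l, ((1 / (1 + t l ^ 2) : ℝ) : ℂ) = ((1 / (1 + t i ^ 2) : ℝ) : ℂ) *
      ((1 / (1 + t j ^ 2) : ℝ) : ℂ) * ∏ l ∈ Finset.univ \ {i, j}, ((1 / (1 + t l ^ 2) : ℝ) : ℂ) := by
    rw [← Finset.prod_sdiff (Finset.subset_univ {i, j}), mul_comm, Finset.prod_pair hij]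
  have hpi : (Real.pi : ℂ) ^ n ≠ 0 := pow_ne_zero _ (Complex.ofReal_ne_zero.mpr Real.pi_ne_zero)
  have algebra : ∀ A B J P a b c u v q : ℂ, P ≠ 0 → A * (a * u) * (B * (b * v)) * (J * (c * q)) =
      A * B * J * P * (1 / P * (a * b * c) * (u * v * q)) := by
    intro A B J P a b c u v q hP
    field_simp
  rw [h1, h2, h3, cauchyWeight_eq, hw]
  exact algebra _ _ _ _ _ _ _ _ _ _ hpi

lemma nevanlinnaCondition_iff {n : ℕ} {μ : Measure (Fin n → ℝ)} :
    NevanlinnaCondition n μ ↔ TorusNevanlinna (toTorus μ) := by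
  have key : ∀ (z : Fin n → ℂ) (hz : ∀ k, 0 < (z k).im) (i j : Fin n), i < j →
      ((∫ t : Fin n → ℝ, (((t i : ℂ) - z i) ^ 2)⁻¹ * (((t j : ℂ) - conj (z j)) ^ 2)⁻¹ *
        ∏ l ∈ Finset.univ \ {i, j},
          (1 / ((t l : ℂ) - z l) - 1 / ((t l : ℂ) - conj (z l))) ∂μ) = 0 ↔
      ∫ x, cauchySqMap (cayleyBall (z i) (hz i)) (x i) *
        star (cauchySqMap (cayleyBall (z j) (hz j)) (x j)) *
        ∏ l ∈ Finset.univ \ {i, j}, poissonMap (cayleyBall (z l) (hz l)) (x l) ∂(toTorus μ) = 0) := by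
    intro z hz i j hij
    have h0 : ∀ l, -4 / (z l + Complex.I) ^ 2 ≠ 0 := fun l =>
      div_ne_zero (by norm_num) (pow_ne_zero _ (add_I_ne_zero (hz l).le))
    have hc := mul_ne_zero (mul_ne_zero (mul_ne_zero (h0 i) ((map_ne_zero (starRingEnd ℂ)).mpr (h0 j)))
      (pow_ne_zero (Finset.univ \ {i, j} : Finset (Fin n)).card
        (mul_ne_zero two_ne_zero Complex.I_ne_zero)))
      (pow_ne_zero n (Complex.ofReal_ne_zero.mpr Real.pi_ne_zero))
    have hcont : Continuous fun x : Fin n → UnitAddCircle =>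
        cauchySqMap (cayleyBall (z i) (hz i)) (x i) *
        star (cauchySqMap (cayleyBall (z j) (hz j)) (x j)) *
        ∏ l ∈ Finset.univ \ {i, j}, poissonMap (cayleyBall (z l) (hz l)) (x l) := by fun_prop
    have heq := integral_congr_ae (μ := μ) (Filter.Eventually.of_forall fun t =>
      nevanlinna_integrand_eq hz t hij.ne)
    rw [integral_const_mul, ← integral_toTorus μ hcont] at heq
    refine (Eq.congr_left heq).trans ?_
    rw [mul_eq_zero]
    exact or_iff_right hc
  constructor
  · intro h w i j hij
    have hw := fun l => mem_ball_zero_iff.mp (w l).2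
    have hz : ∀ l, 0 < (cayleySymm (w l)).im := fun l => im_cayleySymm_pos (hw l)
    have hwz : ∀ l, cayleyBall (cayleySymm (w l)) (hz l) = w l := fun l =>
      Subtype.ext (cayley_cayleySymm (one_sub_ne_zero_of_norm_lt_one (hw l)))
    have := (key _ hz i j hij).mp (h _ hz i j hij)
    simpa only [hwz] using this
  · exact fun h z hz i j hij => (key z hz i j hij).mpr (h (fun l => cayleyBall (z l) (hz l)) i j hij)

lemma integrable_prod_cauchyMap {n : ℕ} (σ : Measure (Fin n → UnitAddCircle)) [IsFiniteMeasure σ]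
    (w : Fin n → Metric.ball (0 : ℂ) 1) :
    Integrable (fun x : Fin n → UnitAddCircle => ∏ j, cauchyMap (w j) (x j)) σ := by
  simp only [← torusProd_apply]
  exact ContinuousMap.integrable_of_isFiniteMeasure _ _

lemma integral_two_mul_prod_sub_one {n : ℕ} (σ : Measure (Fin n → UnitAddCircle))
    [IsFiniteMeasure σ] (w : Fin n → Metric.ball (0 : ℂ) 1) :
    ∫ x : Fin n → UnitAddCircle, (2 * ∏ j, cauchyMap (w j) (x j) - 1) ∂σ =
      2 * ∫ x : Fin n → UnitAddCircle, ∏ j, cauchyMap (w j) (x j) ∂σ - (σ.real Set.univ : ℂ) := by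
  rw [integral_sub ((integrable_prod_cauchyMap σ w).const_mul 2) (integrable_const 1),
    integral_const_mul, integral_const]
  simp

lemma integral_prod_cauchyMap_zero {n : ℕ} (σ : Measure (Fin n → UnitAddCircle)) :
    ∫ x : Fin n → UnitAddCircle, ∏ j, cauchyMap ((fun _ => 0 : Fin n → Metric.ball (0 : ℂ) 1) j) (x j) ∂σ
      = (σ.real Set.univ : ℂ) := by
  simp [cauchyKernel]

lemma real_univ_sum_faceMeasure {n : ℕ} (b : Fin n → NNReal) :
    (((∑ j, b j • faceMeasure j : Measure (Fin n → UnitAddCircle)).real Set.univ : ℝ) : ℂ) =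
      ∑ j, (b j : ℂ) := by
  rw [← integral_prod_cauchyMap_zero, integral_sum_faceMeasure_cauchyMap]
  simp

/-- The linear term of the representation is the contribution of the faces of the torus. -/
lemma integral_add_sum_faceMeasure {n : ℕ} (σ : Measure (Fin n → UnitAddCircle))
    [IsFiniteMeasure σ] (b : Fin n → NNReal) (w : Fin n → Metric.ball (0 : ℂ) 1) :
    Complex.I * ∫ x : Fin n → UnitAddCircle,
        (2 * ∏ j, cauchyMap (w j) (x j) - 1) ∂(σ + ∑ j, b j • faceMeasure j) =
      ∑ j, (b j : ℂ) * cayleySymm (w j) +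
        Complex.I * ∫ x : Fin n → UnitAddCircle, (2 * ∏ j, cauchyMap (w j) (x j) - 1) ∂σ := by
  have hI : ∀ (τ : Measure (Fin n → UnitAddCircle)) [IsFiniteMeasure τ], Integrable
      (fun x : Fin n → UnitAddCircle => 2 * ∏ j, cauchyMap (w j) (x j) - 1) τ := fun τ _ =>
    ((integrable_prod_cauchyMap τ w).const_mul 2).sub (integrable_const 1)
  have hs : ∀ j, cayleySymm (w j) = Complex.I * (2 * (1 - (w j : ℂ))⁻¹ - 1) := fun j => by
    have := one_sub_ne_zero_of_norm_lt_one (mem_ball_zero_iff.mp (w j).2)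
    rw [cayleySymm]
    field_simp
    ring
  rw [integral_add_measure (hI _) (hI _), integral_two_mul_prod_sub_one (∑ j, b j • faceMeasure j),
    integral_sum_faceMeasure_cauchyMap, real_univ_sum_faceMeasure, mul_add, add_comm,
    Finset.mul_sum, ← Finset.sum_sub_distrib, Finset.mul_sum]
  simp_rw [hs]
  congr 1
  refine Finset.sum_congr rfl fun j _ => ?_
  ring

lemma cayleyBall_cayleySymm (w : Metric.ball (0 : ℂ) 1) (h : 0 < (cayleySymm w).im) :
    cayleyBall (cayleySymm w) h = w :=
  Subtype.ext (cayley_cayleySymm (one_sub_ne_zero_of_norm_lt_one (mem_ball_zero_iff.mp w.2)))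

/-- The integral representation, transported to the torus. -/
lemma herglotzNvarRep_iff {n : ℕ} {F : (Fin n → ℂ) → ℂ} {a : ℝ} {b : Fin n → NNReal}
    {μ : Measure (Fin n → ℝ)} :
    HerglotzNvarRep n F a (fun j => (b j : ℝ)) μ ↔
      IsFiniteMeasure (toTorus μ) ∧ MixedFree (toTorus μ) ∧
      ∀ w : Fin n → Metric.ball (0 : ℂ) 1, F (fun j => cayleySymm (w j)) =
        a + Complex.I * ∫ x : Fin n → UnitAddCircle,
          (2 * ∏ j, cauchyMap (w j) (x j) - 1) ∂(toTorus μ + ∑ j, b j • faceMeasure j) := by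
  rw [HerglotzNvarRep, nevanlinnaCondition_iff, herglotzGrowthCondition_iff]
  constructor
  · rintro ⟨-, hN, hG, h⟩
    refine ⟨hG, hN.mixedFree, fun w => ?_⟩
    have hz : ∀ l, 0 < (cayleySymm (w l)).im := fun l =>
      im_cayleySymm_pos (mem_ball_zero_iff.mp (w l).2)
    rw [h (fun j => cayleySymm (w j)) hz, integral_herglotzKernel μ hz,
      integral_add_sum_faceMeasure]
    simp only [cayleyBall_cayleySymm, add_assoc]
  · rintro ⟨hG, hM, h⟩
    refine ⟨fun j => (b j).2, hM.torusNevanlinna, hG, fun z hz => ?_⟩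
    have hs : ∀ j, cayleySymm (cayleyBall (z j) (hz j)) = z j := fun j =>
      cayleySymm_cayley (hz j).le
    have := h fun j => cayleyBall (z j) (hz j)
    rw [integral_add_sum_faceMeasure] at this
    simp only [hs] at this
    rw [this, integral_herglotzKernel μ hz, add_assoc]

lemma differentiableAt_integral_cauchyKernel_mul {n : ℕ} (σ : Measure (Fin n → UnitAddCircle))
    [IsFiniteMeasure σ] (j : Fin n) {R : (Fin n → UnitAddCircle) → ℂ} (hR : Continuous R)
    {u : ℂ} (hu : ‖u‖ < 1) :
    DifferentiableAt ℂ (fun v => ∫ x, cauchyKernel v (x j) * R x ∂σ) u := by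
  obtain ⟨r, hr, hr1⟩ := exists_between hu
  have hs : Metric.ball (0 : ℂ) r ∈ nhds u :=
    Metric.isOpen_ball.mem_nhds (mem_ball_zero_iff.mpr hr)
  have hI : ∀ g : (Fin n → UnitAddCircle) → ℂ, Continuous g → Integrable g σ := fun g hg =>
    ContinuousMap.integrable_of_isFiniteMeasure σ ⟨g, hg⟩
  have hc : ∀ v : ℂ, ‖v‖ < 1 → Continuous fun x : Fin n → UnitAddCircle => cauchyKernel v (x j) :=
    fun v hv => (continuous_cauchyKernel hv).comp (continuous_apply j)
  have hc' : ∀ v : ℂ, ‖v‖ < 1 → Continuous fun x : Fin n → UnitAddCircle =>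
      conj (circleCoord (x j)) * cauchyKernel v (x j) ^ 2 * R x := by
    intro v hv
    have := hc v hv
    have h2 : Continuous fun x : Fin n → UnitAddCircle => conj (circleCoord (x j)) :=
      Complex.continuous_conj.comp (continuous_circleCoord.comp (continuous_apply j))
    exact (h2.mul (this.pow 2)).mul hR
  refine (hasDerivAt_integral_of_dominated_loc_of_deriv_le (𝕜 := ℂ)
    (F := fun v x => cauchyKernel v (x j) * R x)
    (F' := fun v x => conj (circleCoord (x j)) * cauchyKernel v (x j) ^ 2 * R x)
    (bound := fun x => ((1 - r)⁻¹) ^ 2 * ‖R x‖) hs ?_ ?_ ?_ ?_ ?_ ?_).2.differentiableAt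
  · filter_upwards [hs] with v hv
    exact (hI _ ((hc v ((mem_ball_zero_iff.mp hv).trans hr1)).mul hR)).aestronglyMeasurable
  · exact hI _ ((hc u hu).mul hR)
  · exact (hI _ (hc' u hu)).aestronglyMeasurable
  · refine Filter.Eventually.of_forall fun x v hv => ?_
    have hv' := mem_ball_zero_iff.mp hv
    have h1 : 1 - r ≤ ‖1 - v * conj (circleCoord (x j))‖ := by
      have := norm_sub_norm_le 1 (v * conj (circleCoord (x j)))
      rw [norm_one, norm_mul, RCLike.norm_conj, norm_circleCoord, mul_one] at this
      linarith
    rw [norm_mul, norm_mul, RCLike.norm_conj, norm_circleCoord, one_mul, norm_pow, cauchyKernel,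
      norm_inv]
    have : 0 < 1 - r := sub_pos.mpr hr1
    gcongr
  · exact (hI R hR).norm.const_mul _
  · refine Filter.Eventually.of_forall fun x v hv => ?_
    have h0 := one_sub_mul_conj_circleCoord_ne_zero ((mem_ball_zero_iff.mp hv).trans hr1) (x j)
    have h1 : HasDerivAt (fun v => 1 - v * conj (circleCoord (x j))) (-conj (circleCoord (x j))) v := by
      simpa using ((hasDerivAt_id v).mul_const (conj (circleCoord (x j)))).const_sub 1
    refine ((h1.fun_inv h0).mul_const (R x)).congr_deriv ?_
    simp only [cauchyKernel]
    field_simp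

lemma differentiableAt_cayley {z : ℂ} (hz : 0 < z.im) : DifferentiableAt ℂ cayley z := by
  unfold cayley
  exact DifferentiableAt.fun_div (by fun_prop) (by fun_prop) (add_I_ne_zero hz.le)

lemma differentiableAt_cayleySymm {w : ℂ} (hw : ‖w‖ < 1) : DifferentiableAt ℂ cayleySymm w := by
  unfold cayleySymm
  exact DifferentiableAt.fun_div (by fun_prop) (by fun_prop) (one_sub_ne_zero_of_norm_lt_one hw)

section Representation

variable {n : ℕ} {F : (Fin n → ℂ) → ℂ}

lemma eq_integral_cayley {a : ℝ} {b : Fin n → NNReal} {μ : Measure (Fin n → ℝ)}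
    (h : HerglotzNvarRep n F a (fun j => (b j : ℝ)) μ) {z : Fin n → ℂ} (hz : ∀ k, 0 < (z k).im) :
    F z = a + Complex.I * ∫ x : Fin n → UnitAddCircle,
      (2 * ∏ j, cauchyMap (cayleyBall (z j) (hz j)) (x j) - 1)
        ∂(toTorus μ + ∑ j, b j • faceMeasure j) := by
  have hs : ∀ j, cayleySymm (cayleyBall (z j) (hz j)) = z j := fun j =>
    cayleySymm_cayley (hz j).le
  have := (herglotzNvarRep_iff.mp h).2.2 fun j => cayleyBall (z j) (hz j)
  simpa only [hs] using this

lemma HerglotzNvarRep.differentiableAt {a : ℝ} {b : Fin n → NNReal} {μ : Measure (Fin n → ℝ)}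
    (h : HerglotzNvarRep n F a (fun j => (b j : ℝ)) μ) (j : Fin n) {z : Fin n → ℂ}
    (hz : ∀ k, 0 < (z k).im) :
    DifferentiableAt ℂ (fun w => F (Function.update z j w)) (z j) := by
  have hfin := (herglotzNvarRep_iff.mp h).1
  set σ := toTorus μ + ∑ j, b j • faceMeasure j with hσ
  have hR : Continuous fun x : Fin n → UnitAddCircle =>
      ∏ l ∈ Finset.univ.erase j, cauchyKernel (cayley (z l)) (x l) :=
    continuous_finsetProd _ fun l _ =>
      (continuous_cauchyKernel (norm_cayley_lt_one (hz l))).comp (continuous_apply l)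
  have hd : DifferentiableAt ℂ (fun w => (a : ℂ) + Complex.I * (2 * ∫ x : Fin n → UnitAddCircle,
      cauchyKernel (cayley w) (x j) *
        ∏ l ∈ Finset.univ.erase j, cauchyKernel (cayley (z l)) (x l) ∂σ -
      (σ.real Set.univ : ℂ))) (z j) := by
    have := (differentiableAt_integral_cauchyKernel_mul σ j hR (norm_cayley_lt_one (hz j))).comp
      (z j) (differentiableAt_cayley (hz j))
    exact (((this.const_mul 2).sub_const _).const_mul _).const_add _
  refine hd.congr_of_eventuallyEq ?_
  filter_upwards [(isOpen_lt continuous_const Complex.continuous_im).mem_nhds (hz j)] with w hw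
  have hw' : ∀ k, 0 < (Function.update z j w k).im := by
    intro k
    by_cases hk : k = j
    · subst hk
      simpa using hw
    · simpa [hk] using hz k
  rw [eq_integral_cayley h hw', integral_two_mul_prod_sub_one]
  congr 6
  funext x
  rw [← Finset.mul_prod_erase _ _ (Finset.mem_univ j)]
  simp only [cauchyMap_apply, cayleyBall, Function.update_self]
  congr 1
  refine Finset.prod_congr rfl fun l hl => ?_
  rw [Function.update_of_ne (Finset.ne_of_mem_erase hl)]

lemma mixedFree_toTorus_add {a : ℝ} {b : Fin n → NNReal} {μ : Measure (Fin n → ℝ)}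
    (h : HerglotzNvarRep n F a (fun j => (b j : ℝ)) μ) :
    MixedFree (toTorus μ + ∑ j, b j • faceMeasure j) := by
  obtain ⟨hfin, hM, -⟩ := herglotzNvarRep_iff.mp h
  exact hM.add (mixedFree_sum_faceMeasure b)

lemma HerglotzNvarRep.im_nonneg {a : ℝ} {b : Fin n → NNReal} {μ : Measure (Fin n → ℝ)}
    (h : HerglotzNvarRep n F a (fun j => (b j : ℝ)) μ) {z : Fin n → ℂ} (hz : ∀ k, 0 < (z k).im) :
    0 ≤ (F z).im := by
  have hfin := (herglotzNvarRep_iff.mp h).1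
  have := (mixedFree_toTorus_add h).re_integral_nonneg fun j => cayleyBall (z j) (hz j)
  rw [eq_integral_cayley h hz, Complex.add_im, Complex.ofReal_im, zero_add, Complex.I_mul_im]
  exact this

lemma HerglotzNvarRep.unique {a a' : ℝ} {b b' : Fin n → NNReal} {μ μ' : Measure (Fin n → ℝ)}
    (h : HerglotzNvarRep n F a (fun j => (b j : ℝ)) μ)
    (h' : HerglotzNvarRep n F a' (fun j => (b' j : ℝ)) μ') : a = a' ∧ b = b' ∧ μ = μ' := by
  obtain ⟨hfin, hM, hF⟩ := herglotzNvarRep_iff.mp h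
  obtain ⟨hfin', hM', hF'⟩ := herglotzNvarRep_iff.mp h'
  set σ := toTorus μ + ∑ j, b j • faceMeasure j with hσ
  set σ' := toTorus μ' + ∑ j, b' j • faceMeasure j with hσ'
  have key : ∀ w : Fin n → Metric.ball (0 : ℂ) 1,
      (a : ℂ) + Complex.I * (2 * ∫ x : Fin n → UnitAddCircle, ∏ j, cauchyMap (w j) (x j) ∂σ -
        (σ.real Set.univ : ℂ)) =
      (a' : ℂ) + Complex.I * (2 * ∫ x : Fin n → UnitAddCircle, ∏ j, cauchyMap (w j) (x j) ∂σ' -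
        (σ'.real Set.univ : ℂ)) := by
    intro w
    rw [← integral_two_mul_prod_sub_one, ← integral_two_mul_prod_sub_one, ← hF w, ← hF' w]
  have h0 := key fun _ => 0
  rw [integral_prod_cauchyMap_zero σ, integral_prod_cauchyMap_zero σ'] at h0
  have ha : a = a' := by simpa using congrArg Complex.re h0
  have hm : σ.real Set.univ = σ'.real Set.univ := by
    have := congrArg Complex.im h0
    simp at this
    linarith
  have hσσ' : σ = σ' := by
    refine (mixedFree_toTorus_add h).eq_of_integral_cauchyMap_eq (mixedFree_toTorus_add h')
      fun w => ?_
    have := key w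
    rw [ha, hm] at this
    simpa using this
  obtain ⟨hb, hμ⟩ := eq_of_add_sum_faceMeasure_eq (toTorus_face μ) (toTorus_face μ') hσσ'
  exact ⟨ha, hb, by rw [← ofTorus_toTorus μ, hμ, ofTorus_toTorus]⟩

lemma exists_herglotzNvarRep
    (hF : ∀ (j : Fin n) (z : Fin n → ℂ), (∀ k, 0 < (z k).im) →
      DifferentiableAt ℂ (fun w => F (Function.update z j w)) (z j))
    (him : ∀ z : Fin n → ℂ, (∀ k, 0 < (z k).im) → 0 ≤ (F z).im) :
    ∃ (a : ℝ) (b : Fin n → NNReal) (μ : Measure (Fin n → ℝ)),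
      HerglotzNvarRep n F a (fun j => (b j : ℝ)) μ := by
  set f : (Fin n → ℂ) → ℂ := fun w => -Complex.I * F fun j => cayleySymm (w j) with hf
  have hol : SeparatelyHolomorphic f := by
    intro j w hw
    have hu : ∀ u, (fun k => cayleySymm (Function.update w j u k)) =
        Function.update (fun k => cayleySymm (w k)) j (cayleySymm u) := fun u => by
      funext k
      by_cases hk : k = j
      · subst hk
        simp
      · simp [hk]
    simp only [hf, hu]
    have hd := hF j (fun k => cayleySymm (w k)) fun k => im_cayleySymm_pos (hw k)
    exact (hd.comp (w j) (differentiableAt_cayleySymm (hw j))).const_mul _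
  have hre : ∀ w ∈ polydisc n, 0 ≤ (f w).re := by
    intro w hw
    simpa [hf] using him (fun k => cayleySymm (w k)) fun k => im_cayleySymm_pos (hw k)
  obtain ⟨σ, hfin, hM, hσ⟩ := exists_mixedFree_measure hol hre
  set τ := σ.restrict {x | ∀ j, x j ≠ 0} with hτ
  have hface : ∀ j, τ {x | x j = 0} = 0 := by
    intro j
    rw [hτ, Measure.restrict_apply (measurableSet_face j)]
    have : {x : Fin n → UnitAddCircle | x j = 0} ∩ {x | ∀ j, x j ≠ 0} = ∅ := by
      ext x
      simp only [Set.mem_inter_iff, Set.mem_ofPred_eq, Set.mem_empty_iff_false, iff_false, not_and]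
      exact fun h h' => h' j h
    rw [this, measure_empty]
  have hdec := hM.decomposition
  refine ⟨-(f 0).im, fun j => (σ {x | x j = 0}).toNNReal, ofTorus τ, herglotzNvarRep_iff.mpr ?_⟩
  rw [toTorus_ofTorus hface, ← hdec]
  refine ⟨inferInstance, ?_, fun w => ?_⟩
  · rw [hdec] at hM
    exact hM.of_add (mixedFree_sum_faceMeasure _)
  · have h1 : F (fun j => cayleySymm (w j)) = Complex.I * f fun j => w j := by
      simp only [hf, ← mul_assoc]
      simp
    rw [h1, hσ w, mul_add, ← mul_assoc, Complex.I_mul_I]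
    push_cast
    ring

end Representation

/-- A function `F : (ℂ⁺)ⁿ → ℂ` is a Herglotz-Nevanlinna function in
`n` variables (holomorphic in each variable with `Im F ≥ 0`) if and only if it admits
the integral representation `F(z) = a + ∑ b_ℓ z_ℓ + (1/πⁿ) ∫ K_n(z, t) dμ(t)` with
`a ∈ ℝ`, `b ∈ [0, ∞)ⁿ` and `μ` a positive Borel measure on `ℝⁿ` satisfying the
Nevanlinna condition and the growth condition; moreover the representing triple
`(a, b, μ)` is unique. -/
theorem stmt_17 (n : ℕ) (hn : 1 ≤ n) (F : (Fin n → ℂ) → ℂ) :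
    (((∀ (j : Fin n) (z : Fin n → ℂ), (∀ k, 0 < (z k).im) →
        DifferentiableAt ℂ (fun w => F (Function.update z j w)) (z j)) ∧
      (∀ z : Fin n → ℂ, (∀ k, 0 < (z k).im) → 0 ≤ (F z).im)) ↔
      ∃ (a : ℝ) (b : Fin n → ℝ) (μ : Measure (Fin n → ℝ)), HerglotzNvarRep n F a b μ) ∧
    (∀ (a a' : ℝ) (b b' : Fin n → ℝ) (μ μ' : Measure (Fin n → ℝ)),
      HerglotzNvarRep n F a b μ → HerglotzNvarRep n F a' b' μ' →
      a = a' ∧ b = b' ∧ μ = μ') := by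
  refine ⟨⟨fun ⟨hF, him⟩ => ?_, ?_⟩, ?_⟩
  · obtain ⟨a, b, μ, h⟩ := exists_herglotzNvarRep hF him
    exact ⟨a, _, μ, h⟩
  · rintro ⟨a, b, μ, h⟩
    lift b to Fin n → NNReal using h.1
    exact ⟨fun j z hz => h.differentiableAt j hz, fun z hz => h.im_nonneg hz⟩
  · intro a a' b b' μ μ' h h'
    lift b to Fin n → NNReal using h.1
    lift b' to Fin n → NNReal using h'.1
    obtain ⟨ha, rfl, hμ⟩ := h.unique h'
    exact ⟨ha, rfl, hμ⟩
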